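/- arXiv:2001.01239 — 3 statements merged into one kernel-verified Lean document; each statement's English description precedes it below -/
import Mathlib

section
/- Suppose p > p_S. Then there exist T ∈ ℝ and a function y ∈ C²((−∞,T]) satisfying y''(t) + α y'(t) − y(t) + y(t)^p − m² e^{2mt} y(t) = 0 for all t ≤ T together with y(t) → 1 as t → −∞; moreover such a solution is unique, i.e. if y₁ on (−∞,T₁] and y₂ on (−∞,T₂] both satisfy this equation and tend to 1 as t → −∞, then y₁ = y₂ on (−∞, min(T₁,T₂)]. -/
open Real Set Filter Topology MeasureTheory

noncomputable section

/-- The nonlinearity `f(u) = -u + u^p`. -/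
def fNL (p u : ℝ) : ℝ := -u + u ^ p

/-- The Sobolev critical exponent `p_S = (N+2)/(N-2)`. -/
def pSob (N : ℕ) : ℝ := ((N : ℝ) + 2) / ((N : ℝ) - 2)

/-- `θ = 2/(p-1)`. -/
def thetaP (p : ℝ) : ℝ := 2 / (p - 1)

/-- `A = (θ(N-2-θ))^{1/(p-1)}`. -/
def Aconst (N : ℕ) (p : ℝ) : ℝ :=
  (thetaP p * ((N : ℝ) - 2 - thetaP p)) ^ (1 / (p - 1))

/-- `m = (θ(N-2-θ))^{-1/2}`. -/
def mConst (N : ℕ) (p : ℝ) : ℝ :=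
  (thetaP p * ((N : ℝ) - 2 - thetaP p)) ^ (-(1 / 2) : ℝ)

/-- `α = m(N-2-2θ)`. -/
def alphaConst (N : ℕ) (p : ℝ) : ℝ :=
  mConst N p * ((N : ℝ) - 2 - 2 * thetaP p)

/-- The condition `p < p_JL`, where `p_JL = 1 + 4/(N-4-2√(N-1))` for `N ≥ 11` and
`p_JL = ∞` for `N ≤ 10`. -/
def pJLcond (N : ℕ) (p : ℝ) : Prop :=
  11 ≤ N → p < 1 + 4 / ((N : ℝ) - 4 - 2 * Real.sqrt ((N : ℝ) - 1))

/-- `y` is a C² solution of `y'' + α y' - y + y^p - m² e^{2mt} y = 0` on `(-∞, T]`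
with `y → 1` as `t → -∞`; `y'`, `y''` are its first and second derivatives. -/
def IsSingODEOn (N : ℕ) (p T : ℝ) (y y' y'' : ℝ → ℝ) : Prop :=
  (∀ t ∈ Iic T, HasDerivWithinAt y (y' t) (Iic T) t) ∧
  (∀ t ∈ Iic T, HasDerivWithinAt y' (y'' t) (Iic T) t) ∧
  ContinuousOn y'' (Iic T) ∧
  (∀ t ∈ Iic T, y'' t + alphaConst N p * y' t - y t + y t ^ p
      - (mConst N p) ^ 2 * Real.exp (2 * mConst N p * t) * y t = 0) ∧
  Tendsto y atBot (𝓝 1)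

/-- `y` is a C² solution of `y'' + α y' - y + y^p - m² e^{2mt} y = 0` on all of `ℝ`
with `y → 1` as `t → -∞`. -/
def IsEntireSingODE (N : ℕ) (p : ℝ) (y y' y'' : ℝ → ℝ) : Prop :=
  (∀ t : ℝ, HasDerivAt y (y' t) t) ∧
  (∀ t : ℝ, HasDerivAt y' (y'' t) t) ∧
  Continuous y'' ∧
  (∀ t : ℝ, y'' t + alphaConst N p * y' t - y t + y t ^ p
      - (mConst N p) ^ 2 * Real.exp (2 * mConst N p * t) * y t = 0) ∧
  Tendsto y atBot (𝓝 1)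

/-- The singular solution `u*(s) = A s^{-θ} y*(m⁻¹ log s)` built from `y*`. -/
def ustar (N : ℕ) (p : ℝ) (y : ℝ → ℝ) (s : ℝ) : ℝ :=
  Aconst N p * s ^ (-(thetaP p)) * y (Real.log s / mConst N p)

/-- `u` is a C² solution on `[0,∞)` of the IVP `u'' + ((N-1)/s)u' + f(u) = 0`,
`u(0) = γ`, `u'(0) = 0`, with nonlinearity `f(u) = -u + u^p`. -/
def IsIVPSol (N : ℕ) (p γ : ℝ) (u u' u'' : ℝ → ℝ) : Prop :=
  (∀ s ∈ Ici (0:ℝ), HasDerivWithinAt u (u' s) (Ici 0) s) ∧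
  (∀ s ∈ Ici (0:ℝ), HasDerivWithinAt u' (u'' s) (Ici 0) s) ∧
  ContinuousOn u'' (Ici 0) ∧
  u 0 = γ ∧ u' 0 = 0 ∧
  (∀ s > (0:ℝ), u'' s + ((N : ℝ) - 1) / s * u' s + fNL p (u s) = 0)

/-- `u` is a C² solution on `[0,∞)` of the IVP `u'' + ((N-1)/ρ)u' + u^p = 0`,
`u(0) = γ`, `u'(0) = 0`. -/
def IsBarSol (N : ℕ) (p γ : ℝ) (u u' u'' : ℝ → ℝ) : Prop :=
  (∀ ρ ∈ Ici (0:ℝ), HasDerivWithinAt u (u' ρ) (Ici 0) ρ) ∧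
  (∀ ρ ∈ Ici (0:ℝ), HasDerivWithinAt u' (u'' ρ) (Ici 0) ρ) ∧
  ContinuousOn u'' (Ici 0) ∧
  u 0 = γ ∧ u' 0 = 0 ∧
  (∀ ρ > (0:ℝ), u'' ρ + ((N : ℝ) - 1) / ρ * u' ρ + u ρ ^ p = 0)

/-- `s` is the `(k+1)`-th positive critical point of a function whose derivative is `u'`:
`s` is a positive critical point having exactly `k` positive critical points below it. -/
def IsNthCritPt (u' : ℝ → ℝ) (k : ℕ) (s : ℝ) : Prop :=
  0 < s ∧ u' s = 0 ∧ {x : ℝ | 0 < x ∧ x < s ∧ u' x = 0}.encard = (k : ℕ∞)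

/-- `U` is a positive C² radial solution of the Neumann problem
`U'' + ((N-1)/r)U' + λ f(U) = 0` on `(0,1)`, `U'(0) = U'(1) = 0`, `U > 0` on `[0,1]`. -/
def NeumannSol (N : ℕ) (p lam : ℝ) (U U' U'' : ℝ → ℝ) : Prop :=
  (∀ r ∈ Icc (0:ℝ) 1, HasDerivWithinAt U (U' r) (Icc 0 1) r) ∧
  (∀ r ∈ Icc (0:ℝ) 1, HasDerivWithinAt U' (U'' r) (Icc 0 1) r) ∧
  ContinuousOn U'' (Icc 0 1) ∧
  (∀ r ∈ Ioo (0:ℝ) 1, U'' r + ((N : ℝ) - 1) / r * U' r + lam * fNL p (U r) = 0) ∧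
  U' 0 = 0 ∧ U' 1 = 0 ∧ (∀ r ∈ Icc (0:ℝ) 1, 0 < U r)

/-- `(lam, U)` is a singular solution of the Neumann problem whose graph meets `1`
exactly `n` times: `U` is C² on `(0,1)`, continuous on `(0,1]`, `U'(1) = 0`, it solves
`U'' + ((N-1)/r)U' + λ f(U) = 0` on `(0,1)`, satisfies the asymptotics
`U(r) = A(√λ r)^{-θ}(1+o(1))` as `r ↓ 0` (i.e. `r^θ U(r) → A λ^{-θ/2}`),
`U - 1` has exactly `n` zeros in `(0,1]`, and `U > 0` on `(0,1]`. -/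
def SingBVPSol (N : ℕ) (p lam : ℝ) (n : ℕ) (U U' U'' : ℝ → ℝ) : Prop :=
  (∀ r ∈ Ioc (0:ℝ) 1, HasDerivWithinAt U (U' r) (Ioc 0 1) r) ∧
  (∀ r ∈ Ioo (0:ℝ) 1, HasDerivAt U' (U'' r) r) ∧
  ContinuousOn U (Ioc 0 1) ∧
  ContinuousOn U'' (Ioo 0 1) ∧
  (∀ r ∈ Ioo (0:ℝ) 1, U'' r + ((N : ℝ) - 1) / r * U' r + lam * fNL p (U r) = 0) ∧
  U' 1 = 0 ∧
  Tendsto (fun r => r ^ thetaP p * U r) (𝓝[>] (0:ℝ))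
    (𝓝 (Aconst N p * lam ^ (-(thetaP p) / 2))) ∧
  {r ∈ Ioc (0:ℝ) 1 | U r = 1}.encard = (n : ℕ∞) ∧
  (∀ r ∈ Ioc (0:ℝ) 1, 0 < U r)

/-- A quadratic Lyapunov function for `w'' + α w' + β w = r` with `|r| ≤ η |w|`, `η` small. -/
theorem exists_lyapunov_coeff {α β : ℝ} (hα : 0 < α) (hβ : 0 < β) :
    ∃ δ η : ℝ, 0 < η ∧ (∀ w v : ℝ, v ^ 2 + β * w ^ 2 ≤ 2 * (v ^ 2 + β * w ^ 2 + δ * w * v)) ∧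
      ∀ w v r : ℝ, |r| ≤ η * |w| →
        2 * v * (-α * v - β * w + r) + 2 * β * w * v
          + δ * (v * v + w * (-α * v - β * w + r)) ≤ 0 := by
  obtain ⟨δ, hδ, h1, h2, h3⟩ : ∃ δ : ℝ, 0 < δ ∧ δ ≤ α ∧ α * δ ≤ β ∧ δ ^ 2 ≤ β := by
    have hα1 : α * β / (α ^ 2 + β) ≤ α := by
      rw [div_le_iff₀ (by positivity)]; nlinarith [pow_pos hα 3]
    have hβ1 : α * (α * β / (α ^ 2 + β)) ≤ β := by
      rw [← mul_div_assoc, div_le_iff₀ (by positivity)]; nlinarith [pow_pos hα 3]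
    have h0 : 0 < α * β / (α ^ 2 + β) := by positivity
    exact ⟨_, h0, hα1, hβ1, by nlinarith⟩
  refine ⟨δ, min (α / 4) (δ * β / (4 * (1 + δ))), by positivity, fun w v => ?_,
    fun w v r hr => ?_⟩
  · nlinarith [sq_nonneg (v + δ * w), mul_le_mul_of_nonneg_right h3 (sq_nonneg w)]
  · set η := min (α / 4) (δ * β / (4 * (1 + δ)))
    have hη : η ≤ α / 4 := min_le_left _ _
    have hη' : η * (1 + δ) ≤ δ * β / 4 := by
      have : η ≤ δ * β / (4 * (1 + δ)) := min_le_right _ _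
      rw [le_div_iff₀ (by positivity)] at this
      linarith
    have hη0 : 0 < η := by positivity
    have hr1 : r * (2 * v + δ * w) ≤ η * (v ^ 2 + (1 + δ) * w ^ 2) := by
      calc r * (2 * v + δ * w) ≤ |r| * |2 * v + δ * w| := by
            rw [← abs_mul]; exact le_abs_self _
        _ ≤ (η * |w|) * (2 * |v| + δ * |w|) := by
            gcongr
            calc |2 * v + δ * w| ≤ |2 * v| + |δ * w| := abs_add_le _ _
              _ = _ := by rw [abs_mul, abs_mul, abs_of_pos hδ, abs_two]
        _ = η * (2 * |v| * |w| + δ * |w| ^ 2) := by ring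
        _ ≤ η * (|v| ^ 2 + (1 + δ) * |w| ^ 2) := by
            refine mul_le_mul_of_nonneg_left ?_ hη0.le
            nlinarith [sq_nonneg (|v| - |w|)]
        _ = _ := by rw [sq_abs, sq_abs]
    have hcross : -(δ * α * w * v) ≤ α / 2 * v ^ 2 + δ * β / 2 * w ^ 2 := by
      have : α * δ * δ * w ^ 2 ≤ β * δ * w ^ 2 := by gcongr
      nlinarith [mul_nonneg hα.le (sq_nonneg (v + δ * w))]
    have e1 : η * v ^ 2 ≤ α / 4 * v ^ 2 := by gcongr
    have e2 : η * (1 + δ) * w ^ 2 ≤ δ * β / 4 * w ^ 2 := by gcongr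
    have e3 : δ * v ^ 2 ≤ α * v ^ 2 := by gcongr
    nlinarith [mul_nonneg (mul_nonneg hδ.le hβ.le) (sq_nonneg w), mul_nonneg hα.le (sq_nonneg v)]

/-- A solution of a stable, slightly perturbed linear equation that tends to zero at `-∞` is
trivial. -/
theorem eq_zero_of_tendsto_atBot {α β : ℝ} (hα : 0 < α) (hβ : 0 < β) :
    ∃ η > 0, ∀ (T : ℝ) (w v r : ℝ → ℝ),
      (∀ t ∈ Iic T, HasDerivWithinAt w (v t) (Iic T) t) →
      (∀ t ∈ Iic T, HasDerivWithinAt v (-α * v t - β * w t + r t) (Iic T) t) →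
      (∀ t ∈ Iic T, |r t| ≤ η * |w t|) → Tendsto w atBot (𝓝 0) →
      ∀ t ∈ Iic T, w t = 0 ∧ v t = 0 := by
  obtain ⟨δ, η, hη, hpos, hdec⟩ := exists_lyapunov_coeff hα hβ
  refine ⟨η, hη, fun T w v r hw hv hr hlim t ht => ?_⟩
  set E : ℝ → ℝ := fun t => v t ^ 2 + β * w t ^ 2 + δ * w t * v t with hE
  have hEd : ∀ t ∈ Iic T, HasDerivWithinAt E (2 * v t * (-α * v t - β * w t + r t)
      + 2 * β * w t * v t + δ * (v t * v t + w t * (-α * v t - β * w t + r t))) (Iic T) t := by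
    intro t ht
    have := (((hv t ht).pow 2).add (((hw t ht).pow 2).const_mul β)).add
      (((hw t ht).const_mul δ).mul (hv t ht))
    refine this.congr_deriv ?_
    push_cast; ring
  have hanti : AntitoneOn E (Iic T) := by
    refine antitoneOn_of_hasDerivWithinAt_nonpos (convex_Iic T)
      (fun t ht => (hEd t ht).continuousWithinAt)
      (fun t ht => (hEd t (interior_subset ht)).mono interior_subset) fun t ht => ?_
    exact hdec _ _ _ (hr t (interior_subset ht))
  have hmv : ∀ n : ℕ, ∃ ξ ∈ Ioo (min t 0 - n - 1) (min t 0 - n),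
      v ξ = w (min t 0 - n) - w (min t 0 - n - 1) := by
    intro n
    have hn : (0 : ℝ) ≤ n := n.cast_nonneg
    have ht0 : min t 0 ≤ t := min_le_left _ _
    have hsub : Icc (min t 0 - n - 1) (min t 0 - n) ⊆ Iic T := fun x hx =>
      by simp only [mem_Iic, mem_Icc] at *; linarith [hx.2]
    obtain ⟨ξ, hξ, h⟩ := exists_hasDerivAt_eq_slope w v
      (show min t 0 - n - 1 < min t 0 - n by linarith)
      (fun x hx => ((hw x (hsub hx)).continuousWithinAt).mono hsub)
      (fun x hx => (hw x (hsub (Ioo_subset_Icc_self hx))).hasDerivAt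
        (Iic_mem_nhds (by simp only [mem_Iic, mem_Ioo] at *; linarith [hx.2])))
    exact ⟨ξ, hξ, by rw [h]; ring_nf⟩
  choose ξ hξ hvξ using hmv
  have hlin : Tendsto (fun n : ℕ => min t 0 - n) atTop atBot :=
    tendsto_atBot_add_const_left _ _ (tendsto_neg_atTop_atBot.comp tendsto_natCast_atTop_atTop)
  have hlin' : Tendsto (fun n : ℕ => min t 0 - n - 1) atTop atBot :=
    tendsto_atBot_add_const_right _ _ hlin
  have hξlim : Tendsto ξ atTop atBot := tendsto_atBot_mono (fun n => (hξ n).2.le) hlin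
  have hwξ := hlim.comp hξlim
  have hvlim : Tendsto (fun n => v (ξ n)) atTop (𝓝 0) := by
    simp_rw [hvξ]
    simpa using (hlim.comp hlin).sub (hlim.comp hlin')
  have hElim : Tendsto (fun n => E (ξ n)) atTop (𝓝 0) := by
    have := ((hvlim.pow 2).add ((hwξ.pow 2).const_mul β)).add ((hwξ.const_mul δ).mul hvlim)
    simpa [hE] using this
  have hEle : E t ≤ 0 := ge_of_tendsto' hElim fun n => by
    have hξt : ξ n ≤ t := by
      have := (hξ n).2; have : (0:ℝ) ≤ n := n.cast_nonneg
      linarith [min_le_left t 0]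
    exact hanti (hξt.trans ht) ht hξt
  have h := hpos (w t) (v t)
  have h1 : 0 ≤ β * w t ^ 2 := by positivity
  have h2 : 0 ≤ v t ^ 2 := by positivity
  have h3 : v t ^ 2 + β * w t ^ 2 ≤ 0 := by linarith
  have h4 : β * w t ^ 2 = 0 := by linarith
  have h5 : v t ^ 2 = 0 := by linarith
  exact ⟨by simpa [hβ.ne'] using h4, by simpa using h5⟩

/-- Forward uniqueness for a second order linear differential inequality with zero initial data. -/
theorem eq_zero_of_initial_zero {α β K a T : ℝ} (hα : 0 < α) {w v r : ℝ → ℝ}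
    (hw : ∀ t ∈ Icc a T, HasDerivWithinAt w (v t) (Icc a T) t)
    (hv : ∀ t ∈ Icc a T, HasDerivWithinAt v (-α * v t - β * w t + r t) (Icc a T) t)
    (hr : ∀ t ∈ Icc a T, |r t| ≤ K * |w t|) (hwa : w a = 0) (hva : v a = 0) :
    ∀ t ∈ Icc a T, w t = 0 := by
  intro t ht
  set C := |1 - β| + |K|
  set E : ℝ → ℝ := fun t => (v t ^ 2 + w t ^ 2) * exp (-C * t)
  have hEd : ∀ t ∈ Icc a T, HasDerivWithinAt E ((2 * v t * (-α * v t - β * w t + r t)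
      + 2 * w t * v t - C * (v t ^ 2 + w t ^ 2)) * exp (-C * t)) (Icc a T) t := by
    intro t ht
    have := (((hv t ht).pow 2).add ((hw t ht).pow 2)).mul
      (((hasDerivAt_id t).const_mul (-C)).exp).hasDerivWithinAt
    refine this.congr_deriv ?_
    simp; ring
  have hanti : AntitoneOn E (Icc a T) := by
    refine antitoneOn_of_hasDerivWithinAt_nonpos (convex_Icc a T)
      (fun t ht => (hEd t ht).continuousWithinAt)
      (fun t ht => (hEd t (interior_subset ht)).mono interior_subset) fun t ht => ?_
    refine mul_nonpos_of_nonpos_of_nonneg ?_ (exp_pos _).le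
    have h1 : 2 * v t * r t ≤ |K| * (v t ^ 2 + w t ^ 2) := by
      calc 2 * v t * r t ≤ |2 * v t * r t| := le_abs_self _
        _ = 2 * |v t| * |r t| := by rw [abs_mul, abs_mul, abs_two]
        _ ≤ 2 * |v t| * (|K| * |w t|) := by
          gcongr
          exact (hr t (interior_subset ht)).trans (by gcongr; exact le_abs_self K)
        _ = |K| * (2 * |v t| * |w t|) := by ring
        _ ≤ |K| * (|v t| ^ 2 + |w t| ^ 2) := by gcongr; exact two_mul_le_add_sq _ _
        _ = _ := by rw [sq_abs, sq_abs]
    have h2 : 2 * (1 - β) * w t * v t ≤ |1 - β| * (v t ^ 2 + w t ^ 2) := by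
      calc 2 * (1 - β) * w t * v t ≤ |2 * (1 - β) * w t * v t| := le_abs_self _
        _ = |1 - β| * (2 * |v t| * |w t|) := by simp only [abs_mul, abs_two]; ring
        _ ≤ |1 - β| * (|v t| ^ 2 + |w t| ^ 2) := by gcongr; exact two_mul_le_add_sq _ _
        _ = _ := by rw [sq_abs, sq_abs]
    have h3 : 0 ≤ α * v t ^ 2 := by positivity
    have h4 : C * (v t ^ 2 + w t ^ 2)
      = |1 - β| * (v t ^ 2 + w t ^ 2) + |K| * (v t ^ 2 + w t ^ 2) := add_mul _ _ _
    nlinarith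
  have hle : E t ≤ E a := hanti ⟨le_rfl, ht.1.trans ht.2⟩ ht ht.1
  have h0 : v t ^ 2 + w t ^ 2 ≤ 0 := by
    have hEa : E a = 0 := by simp [E, hwa, hva]
    rw [hEa] at hle
    exact nonpos_of_mul_nonpos_left hle (exp_pos _)
  have : w t ^ 2 = 0 := by nlinarith [sq_nonneg (v t), sq_nonneg (w t)]
  simpa using this

/-- The nonlinear remainder of `x ↦ x ^ p` at `1` has arbitrarily small Lipschitz constant. -/
theorem exists_rpow_sub_linear_lipschitz {p η : ℝ} (hη : 0 < η) :
    ∃ ρ > 0, ∀ x y : ℝ, |x| ≤ ρ → |y| ≤ ρ →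
      |((1 + x) ^ p - 1 - p * x) - ((1 + y) ^ p - 1 - p * y)| ≤ η * |x - y| := by
  lift η to NNReal using hη.le
  have hd : HasStrictDerivAt (fun x : ℝ => (1 + x) ^ p - 1 - p * x) 0 0 := by
    have h1 : HasStrictDerivAt (fun x : ℝ => 1 + x) 1 0 := (hasStrictDerivAt_id 0).const_add 1
    have h2 : HasStrictDerivAt (fun x : ℝ => x ^ p) (p * (1 + 0) ^ (p - 1)) (1 + (0 : ℝ)) :=
      Real.hasStrictDerivAt_rpow_const_of_ne (by norm_num) p
    have h3 : HasStrictDerivAt (fun x : ℝ => (1 + x) ^ p - 1 - p * x)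
        (p * (1 + 0) ^ (p - 1) * 1 - p * 1) 0 :=
      ((h2.comp (0 : ℝ) h1).sub_const 1).sub ((hasStrictDerivAt_id (0 : ℝ)).const_mul p)
    rwa [show p * (1 + 0 : ℝ) ^ (p - 1) * 1 - p * 1 = 0 by simp] at h3
  obtain ⟨s, hs, hL⟩ := hd.hasStrictFDerivAt.exists_lipschitzOnWith_of_nnnorm_lt
    η (by simpa using hη)
  obtain ⟨ρ, hρ, hsub⟩ := Metric.nhds_basis_closedBall.mem_iff.1 hs
  refine ⟨ρ, hρ, fun x y hx hy => ?_⟩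
  have := hL.dist_le_mul x (hsub (by simpa using hx)) y (hsub (by simpa using hy))
  rwa [Real.dist_eq, Real.dist_eq] at this

section Existence

open scoped BoundedContinuousFunction

/-- The solution `t ↦ ∫_{-∞}^t e^{-a(t-s)} F(s) ds` of `G' + a G = F`. -/
def expConv (a : ℂ) (F : ℝ → ℂ) (t : ℝ) : ℂ :=
  Complex.exp (-a * t) * ∫ s in Iic t, Complex.exp (a * s) * F s

theorem integrableOn_exp_mul_bounded {a : ℂ} (ha : 0 < a.re) (F : ℝ →ᵇ ℂ) (t : ℝ) :
    IntegrableOn (fun s : ℝ => Complex.exp (a * s) * F s) (Iic t) :=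
  (integrableOn_exp_mul_complex_Iic ha t).mul_bdd (c := ‖F‖) F.continuous.aestronglyMeasurable
    (ae_of_all _ F.norm_coe_le_norm)

theorem hasDerivAt_expConv {a : ℂ} (ha : 0 < a.re) (F : ℝ →ᵇ ℂ) (t : ℝ) :
    HasDerivAt (expConv a F) (F t - a * expConv a F t) t := by
  have hc : Continuous (fun s : ℝ => Complex.exp (a * s) * F s) := by fun_prop
  have hint : HasDerivAt (fun t : ℝ => ∫ s in Iic t, Complex.exp (a * s) * F s)
      (Complex.exp (a * t) * F t) t := by
    have h1 := (intervalIntegral.integral_hasDerivAt_right (hc.intervalIntegrable 0 t)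
      hc.stronglyMeasurable.stronglyMeasurableAtFilter hc.continuousAt).const_add
        (∫ s in Iic (0:ℝ), Complex.exp (a * s) * F s)
    refine h1.congr_of_eventuallyEq (Eventually.of_forall fun u => ?_)
    have := intervalIntegral.integral_Iic_sub_Iic (integrableOn_exp_mul_bounded ha F 0)
      (integrableOn_exp_mul_bounded ha F u)
    exact (eq_add_of_sub_eq' this)
  have hexp : HasDerivAt (fun t : ℝ => Complex.exp (-a * t)) (Complex.exp (-a * t) * (-a)) t := by
    have := ((Complex.ofRealCLM.hasDerivAt (x := t)).const_mul (-a)).cexp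
    simpa using this
  refine (hexp.mul hint).congr_deriv ?_
  have he : Complex.exp (-a * t) * Complex.exp (a * t) = 1 := by
    rw [← Complex.exp_add]; simp
  simp only [expConv]
  linear_combination F t * he

theorem norm_expConv_le {a : ℂ} (ha : 0 < a.re) (F : ℝ →ᵇ ℂ) (t : ℝ) :
    ‖expConv a F t‖ ≤ ‖F‖ / a.re := by
  have h : ‖∫ s in Iic t, Complex.exp (a * s) * F s‖
      ≤ ∫ s in Iic t, rexp (a.re * s) * ‖F‖ := by
    refine norm_integral_le_of_norm_le ((integrableOn_exp_mul_Iic ha t).mul_const _)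
      (ae_of_all _ fun s => ?_)
    rw [norm_mul, Complex.norm_exp]
    simp only [Complex.mul_re, Complex.ofReal_re, Complex.ofReal_im, mul_zero, sub_zero]
    gcongr
    exact F.norm_coe_le_norm s
  rw [integral_mul_const, integral_exp_mul_Iic ha] at h
  calc ‖expConv a F t‖ = rexp (-(a.re * t)) * ‖∫ s in Iic t, Complex.exp (a * s) * F s‖ := by
        rw [expConv, norm_mul, Complex.norm_exp]; simp
    _ ≤ rexp (-(a.re * t)) * (rexp (a.re * t) / a.re * ‖F‖) := by gcongr
    _ = (rexp (-(a.re * t)) * rexp (a.re * t)) * (‖F‖ / a.re) := by ring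
    _ = ‖F‖ / a.re := by rw [← Real.exp_add]; simp

/-- `expConv` as a map on bounded continuous functions. -/
def expConvBCF {a : ℂ} (ha : 0 < a.re) (F : ℝ →ᵇ ℂ) : ℝ →ᵇ ℂ :=
  BoundedContinuousFunction.ofNormedAddCommGroup (expConv a F)
    (continuous_iff_continuousAt.2 fun t => (hasDerivAt_expConv ha F t).continuousAt)
    (‖F‖ / a.re) (norm_expConv_le ha F)

theorem dist_expConvBCF_le {a : ℂ} (ha : 0 < a.re) (F G : ℝ →ᵇ ℂ) :
    dist (expConvBCF ha F) (expConvBCF ha G) ≤ dist F G / a.re := by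
  rw [dist_eq_norm F G, BoundedContinuousFunction.dist_le (by positivity)]
  intro t
  have hsub : expConv a F t - expConv a G t = expConv a (F - G : ℝ →ᵇ ℂ) t := by
    simp only [expConv, BoundedContinuousFunction.coe_sub, Pi.sub_apply, mul_sub]
    rw [integral_sub (integrableOn_exp_mul_bounded ha F t) (integrableOn_exp_mul_bounded ha G t),
      mul_sub]
  calc dist (expConvBCF ha F t) (expConvBCF ha G t) = ‖expConv a (F - G : ℝ →ᵇ ℂ) t‖ := by
        rw [dist_eq_norm, ← hsub]; rfl
    _ ≤ _ := norm_expConv_le ha _ t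

/-- The Nemytskii operator `ζ ↦ F(·, Re ζ)` of a uniformly Lipschitz `F`. -/
def realNemytskii {F : ℝ → ℝ → ℝ} {L C : ℝ} (hF : Continuous (fun q : ℝ × ℝ => F q.1 q.2))
    (hL : ∀ t x y, |F t x - F t y| ≤ L * |x - y|) (hC : ∀ t, |F t 0| ≤ C) (hL0 : 0 ≤ L)
    (ζ : ℝ →ᵇ ℂ) : ℝ →ᵇ ℂ :=
  BoundedContinuousFunction.ofNormedAddCommGroup (fun t => (F t (ζ t).re : ℂ))
    (Complex.continuous_ofReal.comp
      (hF.comp (continuous_id.prodMk (Complex.continuous_re.comp ζ.continuous))))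
    (L * ‖ζ‖ + C) fun t => by
      rw [Complex.norm_real, Real.norm_eq_abs]
      have h1 : |F t (ζ t).re| ≤ |F t (ζ t).re - F t 0| + |F t 0| := by
        simpa using abs_add_le (F t (ζ t).re - F t 0) (F t 0)
      have h2 : L * |(ζ t).re - 0| ≤ L * ‖ζ‖ := by
        rw [sub_zero]
        gcongr
        exact (Complex.abs_re_le_norm _).trans (ζ.norm_coe_le_norm t)
      linarith [hL t (ζ t).re 0, hC t]

theorem dist_realNemytskii_le {F : ℝ → ℝ → ℝ} {L C : ℝ}
    (hF : Continuous (fun q : ℝ × ℝ => F q.1 q.2))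
    (hL : ∀ t x y, |F t x - F t y| ≤ L * |x - y|) (hC : ∀ t, |F t 0| ≤ C) (hL0 : 0 ≤ L)
    (ζ ξ : ℝ →ᵇ ℂ) :
    dist (realNemytskii hF hL hC hL0 ζ) (realNemytskii hF hL hC hL0 ξ) ≤ L * dist ζ ξ := by
  rw [BoundedContinuousFunction.dist_le (by positivity)]
  intro t
  calc dist (realNemytskii hF hL hC hL0 ζ t) (realNemytskii hF hL hC hL0 ξ t)
      = |F t (ζ t).re - F t (ξ t).re| := by
        rw [dist_eq_norm, ← Real.norm_eq_abs, ← Complex.norm_real, Complex.ofReal_sub]; rfl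
    _ ≤ L * |(ζ t).re - (ξ t).re| := hL _ _ _
    _ ≤ L * dist ζ ξ := by
      gcongr
      rw [← Complex.sub_re]
      exact (Complex.abs_re_le_norm _).trans
        ((dist_eq_norm (ζ t) (ξ t)).symm.le.trans (BoundedContinuousFunction.dist_coe_le_dist t))

/-- Bounded solvability of a first order system with a uniformly Lipschitz right-hand side. -/
theorem exists_bounded_system {a b : ℂ} (ha : 0 < a.re) (hb : 0 < b.re) {F : ℝ → ℝ → ℝ}
    {L C : ℝ} (hF : Continuous (fun q : ℝ × ℝ => F q.1 q.2))
    (hL : ∀ t x y, |F t x - F t y| ≤ L * |x - y|) (hC : ∀ t, |F t 0| ≤ C) (hL0 : 0 ≤ L)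
    (hsmall : L < a.re * b.re) :
    ∃ ζ q : ℝ → ℂ, (∃ M, ∀ t, ‖ζ t‖ ≤ M) ∧
      (∀ t, HasDerivAt ζ (q t - a * ζ t) t) ∧
      ∀ t, HasDerivAt q ((F t (ζ t).re : ℂ) - b * q t) t := by
  set N := realNemytskii hF hL hC hL0
  obtain ⟨K, hKL⟩ : ∃ K : NNReal, (K : ℝ) = L / (a.re * b.re) :=
    ⟨_, Real.coe_toNNReal _ (by positivity)⟩
  have hK : ContractingWith K
      (fun ζ : ℝ →ᵇ ℂ => expConvBCF ha (expConvBCF hb (N ζ))) := by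
    refine ⟨?_, LipschitzWith.of_dist_le_mul fun ζ ξ => ?_⟩
    · rw [← NNReal.coe_lt_coe, hKL]
      exact (div_lt_one (by positivity)).2 hsmall
    · calc _ ≤ dist (expConvBCF hb (N ζ)) (expConvBCF hb (N ξ)) / a.re := dist_expConvBCF_le ha _ _
        _ ≤ (dist (N ζ) (N ξ) / b.re) / a.re := by gcongr; exact dist_expConvBCF_le hb _ _
        _ ≤ (L * dist ζ ξ / b.re) / a.re := by
          gcongr; exact dist_realNemytskii_le hF hL hC hL0 ζ ξ
        _ = K * dist ζ ξ := by rw [hKL]; field_simp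
  obtain ⟨ζ, hζ⟩ : ∃ ζ : ℝ →ᵇ ℂ, expConvBCF ha (expConvBCF hb (N ζ)) = ζ :=
    ⟨_, hK.fixedPoint_isFixedPt⟩
  refine ⟨ζ, expConvBCF hb (N ζ), ⟨‖ζ‖, ζ.norm_coe_le_norm⟩, fun t => ?_, fun t => ?_⟩
  · have h := hasDerivAt_expConv ha (expConvBCF hb (N ζ)) t
    have he : expConv a (expConvBCF hb (N ζ)) = ζ := congrArg DFunLike.coe hζ
    rwa [he] at h
  · exact hasDerivAt_expConv hb (N ζ) t

/-- The roots of `x² - α x + β` have positive real part when `α, β > 0`. -/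
theorem exists_stable_factorization {α β : ℝ} (hα : 0 < α) (hβ : 0 < β) :
    ∃ a b : ℂ, 0 < a.re ∧ 0 < b.re ∧ a + b = α ∧ a * b = β := by
  obtain ⟨a, ha⟩ : ∃ a : ℂ, 1 * (a * a) + (-α) * a + β = 0 := by
    refine exists_quadratic_eq_zero one_ne_zero ?_
    obtain ⟨s, hs⟩ := IsAlgClosed.exists_eq_mul_self (discrim 1 (-α : ℂ) β)
    exact ⟨s, hs⟩
  have hre := congrArg Complex.re ha
  have him := congrArg Complex.im ha
  simp at hre him
  have hcase : a.im = 0 ∨ a.re = α / 2 := by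
    have : a.im * (a.re - α / 2) = 0 := by linarith
    rcases mul_eq_zero.1 this with h | h
    · exact Or.inl h
    · exact Or.inr (by linarith)
  refine ⟨a, α - a, ?_, ?_, by ring, by linear_combination -ha⟩
  · rcases hcase with h | h
    · rw [h] at hre; nlinarith [sq_nonneg a.re]
    · rw [h]; positivity
  · simp only [Complex.sub_re, Complex.ofReal_re]
    rcases hcase with h | h
    · rw [h] at hre; nlinarith [sq_nonneg (α - a.re), sq_nonneg a.re]
    · rw [h]; linarith

end Existence

theorem eventually_atBot_mul_exp_lt {c μ ε : ℝ} (hμ : 0 < μ) (hε : 0 < ε) :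
    ∀ᶠ t in atBot, c * exp (μ * t) < ε := by
  have h : Tendsto (fun t => c * exp (μ * t)) atBot (𝓝 (c * 0)) :=
    (tendsto_exp_atBot.comp (tendsto_id.const_mul_atBot hμ)).const_mul c
  rw [mul_zero] at h
  exact h.eventually_lt_const hε

theorem exists_singular_solution {α m p : ℝ} (hα : 0 < α) (hm : 0 < m) (hp : 1 < p) :
    ∃ (T : ℝ) (y y' y'' : ℝ → ℝ), (∀ t, HasDerivAt y (y' t) t) ∧
      (∀ t, HasDerivAt y' (y'' t) t) ∧ Continuous y'' ∧
      (∀ t ∈ Iic T, y'' t + α * y' t - y t + y t ^ p - m ^ 2 * exp (2 * m * t) * y t = 0) ∧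
      Tendsto y atBot (𝓝 1) := by
  obtain ⟨a, b, ha, hb, hsum, hprod⟩ := exists_stable_factorization hα (sub_pos.2 hp)
  set μ := 2 * m with hμ
  have hμ0 : 0 < μ := by positivity
  have ha' : 0 < (a + μ).re := by simp; positivity
  have hb' : 0 < (b + μ).re := by simp; positivity
  set P := (a + μ).re * (b + μ).re
  have hP : 0 < P := by positivity
  obtain ⟨ρ, hρ, hlip⟩ := exists_rpow_sub_linear_lipschitz (p := p) (η := P / 4) (by positivity)
  obtain ⟨T₀, hT₀⟩ := (eventually_atBot_mul_exp_lt (c := m ^ 2) hμ0 (show 0 < P / 4 by positivity)).exists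
  set ψ : ℝ → ℝ := fun x => (1 + x) ^ p - 1 - p * x with hψ
  set c : ℝ → ℝ := fun x => max (-ρ) (min ρ x) with hc
  have hcb : ∀ x, |c x| ≤ ρ := fun x =>
    abs_le.2 ⟨le_max_left _ _, max_le (by linarith) (min_le_left _ _)⟩
  have hcc : ∀ x y, |c x - c y| ≤ |x - y| := fun x y => by
    have := ((LipschitzWith.id.const_min ρ).const_max (-ρ)).dist_le_mul x y
    simpa [Real.dist_eq] using this
  have hcid : ∀ x, |x| ≤ ρ → c x = x := fun x hx => by
    rw [abs_le] at hx
    simp only [hc]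
    rw [min_eq_right hx.2, max_eq_right hx.1]
  have hψc : Continuous ψ := by
    have := Real.continuous_rpow_const (q := p) (by linarith)
    fun_prop
  have hcont : Continuous c := by fun_prop
  set F : ℝ → ℝ → ℝ := fun t x =>
    -exp (-μ * t) * ψ (c (exp (μ * t) * x)) + m ^ 2 * (1 + exp (μ * min t T₀) * x) with hFdef
  have hF : Continuous (fun q : ℝ × ℝ => F q.1 q.2) := by fun_prop
  have hL : ∀ t x y, |F t x - F t y| ≤ (P / 2) * |x - y| := by
    intro t x y
    have h1 : |ψ (c (exp (μ * t) * x)) - ψ (c (exp (μ * t) * y))|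
        ≤ P / 4 * (exp (μ * t) * |x - y|) := by
      refine (hlip _ _ (hcb _) (hcb _)).trans ?_
      gcongr
      refine (hcc _ _).trans_eq ?_
      rw [← mul_sub, abs_mul, abs_of_pos (exp_pos _)]
    have h2 : m ^ 2 * exp (μ * min t T₀) ≤ P / 4 := by
      refine le_trans ?_ hT₀.le
      gcongr
      exact min_le_right _ _
    have he : exp (-μ * t) * exp (μ * t) = 1 := by rw [← Real.exp_add]; simp
    calc |F t x - F t y|
        = |-(exp (-μ * t) * (ψ (c (exp (μ * t) * x)) - ψ (c (exp (μ * t) * y))))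
            + m ^ 2 * exp (μ * min t T₀) * (x - y)| := by
          congr 1; simp only [hFdef]; ring
      _ ≤ exp (-μ * t) * |ψ (c (exp (μ * t) * x)) - ψ (c (exp (μ * t) * y))|
            + m ^ 2 * exp (μ * min t T₀) * |x - y| := by
          refine (abs_add_le _ _).trans_eq ?_
          rw [abs_neg, abs_mul, abs_of_pos (exp_pos _), abs_mul (m ^ 2 * exp (μ * min t T₀)),
            abs_of_pos (show 0 < m ^ 2 * exp (μ * min t T₀) by positivity)]
      _ ≤ exp (-μ * t) * (P / 4 * (exp (μ * t) * |x - y|)) + P / 4 * |x - y| := by gcongr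
      _ = P / 2 * |x - y| := by linear_combination P / 4 * |x - y| * he
  have hF0 : ∀ t, |F t 0| ≤ m ^ 2 := fun t => by
    have hψ0 : ψ (c 0) = 0 := by rw [hcid 0 (by simpa using hρ.le)]; simp [hψ]
    simp [hFdef, hψ0]
  obtain ⟨ζ, q, ⟨M, hM⟩, hζ, hq⟩ := exists_bounded_system ha' hb' hF hL hF0 (by positivity)
    (show P / 2 < P by linarith)
  have hexp : ∀ t : ℝ, HasDerivAt (fun t : ℝ => (exp (μ * t) : ℝ)) (μ * exp (μ * t)) t :=
    fun t => by simpa [mul_comm] using ((hasDerivAt_id t).const_mul μ).exp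
  have hre : ∀ {g : ℝ → ℂ} {g' : ℂ} {t : ℝ}, HasDerivAt g g' t →
      HasDerivAt (fun t => (g t).re) g'.re t := fun h =>
    (Complex.reCLM.hasFDerivAt.comp_hasDerivAt _ h)
  have hζc : Continuous ζ := continuous_iff_continuousAt.2 fun t => (hζ t).continuousAt
  have hqc : Continuous q := continuous_iff_continuousAt.2 fun t => (hq t).continuousAt
  set z : ℝ → ℝ := fun t => exp (μ * t) * (ζ t).re with hz
  have hzle : ∀ t, |z t| ≤ M * exp (μ * t) := fun t => by
    rw [hz]
    simp only
    rw [abs_mul, abs_of_pos (exp_pos _), mul_comm]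
    gcongr
    exact (Complex.abs_re_le_norm _).trans (hM t)
  obtain ⟨T₁, hT₁⟩ := eventually_atBot.1 (eventually_atBot_mul_exp_lt (c := M) hμ0 hρ)
  refine ⟨min T₀ T₁, fun t => 1 + z t, fun t => exp (μ * t) * (q t - a * ζ t).re,
    fun t => exp (μ * t) * ((F t (ζ t).re : ℂ) - (α : ℂ) * q t + a ^ 2 * ζ t).re,
    fun t => ?_, fun t => ?_, ?_, fun t ht => ?_, ?_⟩
  · refine (((hexp t).mul (hre (hζ t))).const_add 1).congr_deriv ?_
    simp; ring
  · refine ((hexp t).mul (hre ((hq t).sub ((hζ t).const_mul a)))).congr_deriv ?_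
    have : (F t (ζ t).re : ℂ) - (α : ℂ) * q t + a ^ 2 * ζ t =
        (μ : ℂ) * (q t - a * ζ t)
          + ((F t (ζ t).re : ℂ) - (b + μ) * q t - a * (q t - (a + μ) * ζ t)) := by
      rw [← hsum]; ring
    simp only [Pi.sub_apply]
    rw [this, Complex.add_re, Complex.re_ofReal_mul]
    ring
  · have : Continuous fun t => F t (ζ t).re :=
      hF.comp (continuous_id.prodMk (Complex.continuous_re.comp hζc))
    fun_prop
  · have htT₀ : t ≤ T₀ := le_trans ht (min_le_left _ _)
    have hzρ : |z t| ≤ ρ := (hzle t).trans (hT₁ t (le_trans ht (min_le_right _ _))).le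
    have hFt : exp (μ * t) * F t (ζ t).re
        = -ψ (z t) + m ^ 2 * exp (μ * t) * (1 + z t) := by
      have he : exp (-μ * t) * exp (μ * t) = 1 := by rw [← Real.exp_add]; simp
      simp only [hFdef]
      rw [min_eq_left htT₀]
      change exp (μ * t) * (-exp (-μ * t) * ψ (c (z t)) + m ^ 2 * (1 + z t)) = _
      rw [hcid _ hzρ]
      linear_combination -ψ (z t) * he
    have halg : (F t (ζ t).re : ℂ) - (α : ℂ) * q t + a ^ 2 * ζ t
        = (F t (ζ t).re : ℂ) - (α : ℂ) * (q t - a * ζ t) - ((p - 1 : ℝ) : ℂ) * ζ t := by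
      rw [← hprod, ← hsum]; ring
    beta_reduce
    rw [halg, Complex.sub_re, Complex.sub_re, Complex.re_ofReal_mul, Complex.re_ofReal_mul,
      Complex.ofReal_re]
    have hzt : z t = exp (μ * t) * (ζ t).re := rfl
    have hψt : ψ (z t) = (1 + z t) ^ p - 1 - p * z t := rfl
    linear_combination hFt - hψt + (p - 1) * hzt
  · have h0 : Tendsto z atBot (𝓝 0) := by
      refine squeeze_zero_norm hzle ?_
      have := (tendsto_exp_atBot.comp (tendsto_id.const_mul_atBot hμ0)).const_mul M
      simpa using this
    simpa using h0.const_add 1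

theorem eqOn_of_singular_solutions {α m p T : ℝ} (hα : 0 < α) (hm : 0 < m) (hp : 1 < p)
    {y₁ y₁' y₁'' y₂ y₂' y₂'' : ℝ → ℝ}
    (h₁ : ∀ t ∈ Iic T, HasDerivWithinAt y₁ (y₁' t) (Iic T) t)
    (h₁' : ∀ t ∈ Iic T, HasDerivWithinAt y₁' (y₁'' t) (Iic T) t)
    (e₁ : ∀ t ∈ Iic T,
      y₁'' t + α * y₁' t - y₁ t + y₁ t ^ p - m ^ 2 * exp (2 * m * t) * y₁ t = 0)
    (l₁ : Tendsto y₁ atBot (𝓝 1))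
    (h₂ : ∀ t ∈ Iic T, HasDerivWithinAt y₂ (y₂' t) (Iic T) t)
    (h₂' : ∀ t ∈ Iic T, HasDerivWithinAt y₂' (y₂'' t) (Iic T) t)
    (e₂ : ∀ t ∈ Iic T,
      y₂'' t + α * y₂' t - y₂ t + y₂ t ^ p - m ^ 2 * exp (2 * m * t) * y₂ t = 0)
    (l₂ : Tendsto y₂ atBot (𝓝 1)) : EqOn y₁ y₂ (Iic T) := by
  obtain ⟨η, hη, hzero⟩ := eq_zero_of_tendsto_atBot hα (sub_pos.2 hp)
  obtain ⟨ρ, hρ, hlip⟩ := exists_rpow_sub_linear_lipschitz (p := p) (half_pos hη)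
  set w : ℝ → ℝ := fun t => y₁ t - y₂ t with hwdef
  set v : ℝ → ℝ := fun t => y₁' t - y₂' t with hvdef
  set r : ℝ → ℝ := fun t =>
    p * w t - (y₁ t ^ p - y₂ t ^ p) + m ^ 2 * exp (2 * m * t) * w t with hrdef
  have hw : ∀ t ∈ Iic T, HasDerivWithinAt w (v t) (Iic T) t :=
    fun t ht => (h₁ t ht).sub (h₂ t ht)
  have hv : ∀ t ∈ Iic T,
      HasDerivWithinAt v (-α * v t - (p - 1) * w t + r t) (Iic T) t := by
    intro t ht
    refine ((h₁' t ht).sub (h₂' t ht)).congr_deriv ?_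
    simp only [hrdef, hwdef, hvdef]
    linear_combination e₁ t ht - e₂ t ht
  have near : ∀ {y : ℝ → ℝ}, Tendsto y atBot (𝓝 1) → ∀ᶠ t in atBot, |y t - 1| ≤ ρ := fun h => by
    filter_upwards [h (Metric.closedBall_mem_nhds 1 hρ)] with t ht
    simpa [Real.dist_eq] using ht
  obtain ⟨S, hS⟩ := eventually_atBot.1 (((near l₁).and (near l₂)).and
    (eventually_atBot_mul_exp_lt (c := m ^ 2) (show 0 < 2 * m by positivity) (half_pos hη)))
  set T₀ := min S T
  have hT₀T : T₀ ≤ T := min_le_right _ _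
  have hsub : Iic T₀ ⊆ Iic T := Iic_subset_Iic.2 hT₀T
  have hr₀ : ∀ t ∈ Iic T₀, |r t| ≤ η * |w t| := by
    intro t ht
    obtain ⟨⟨n₁, n₂⟩, n₃⟩ := hS t (le_trans ht (min_le_left _ _))
    have h := hlip _ _ n₁ n₂
    simp only [add_sub_cancel, sub_sub_sub_cancel_right] at h
    calc |r t| = |-(y₁ t ^ p - 1 - p * (y₁ t - 1) - (y₂ t ^ p - 1 - p * (y₂ t - 1)))
          + m ^ 2 * exp (2 * m * t) * w t| := by
          congr 1; simp only [hrdef, hwdef]; ring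
      _ ≤ η / 2 * |w t| + m ^ 2 * exp (2 * m * t) * |w t| := by
          refine (abs_add_le _ _).trans ?_
          rw [abs_neg, abs_mul (m ^ 2 * exp (2 * m * t)),
            abs_of_pos (show 0 < m ^ 2 * exp (2 * m * t) by positivity)]
          gcongr
      _ ≤ η / 2 * |w t| + η / 2 * |w t| := by gcongr
      _ = η * |w t| := by ring
  have hleft := hzero T₀ w v r (fun t ht => (hw t (hsub ht)).mono hsub)
    (fun t ht => (hv t (hsub ht)).mono hsub) hr₀ (by simpa using l₁.sub l₂)
  have hsub' : Icc T₀ T ⊆ Iic T := fun t ht => ht.2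
  have hbdd : ∀ {y y' : ℝ → ℝ}, (∀ t ∈ Iic T, HasDerivWithinAt y (y' t) (Iic T) t) →
      ∃ R, ∀ t ∈ Icc T₀ T, |y t| ≤ R := fun h =>
    isCompact_Icc.exists_bound_of_continuousOn fun t ht =>
      (h t (hsub' ht)).continuousWithinAt.mono hsub'
  obtain ⟨R₁, hR₁⟩ := hbdd h₁
  obtain ⟨R₂, hR₂⟩ := hbdd h₂
  obtain ⟨K, hK⟩ := (Real.contDiff_rpow_const_of_le (p := p) (n := 1)
    (by simpa using hp.le)).contDiffOn.exists_lipschitzOnWith (by simp)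
      (convex_Icc (-max R₁ R₂) (max R₁ R₂)) isCompact_Icc
  have hr₁ : ∀ t ∈ Icc T₀ T, |r t| ≤ (p + K + m ^ 2 * exp (2 * m * T)) * |w t| := by
    intro t ht
    have hlipK := hK.dist_le_mul (y₁ t) (abs_le.1 ((hR₁ t ht).trans (le_max_left _ _)))
      (y₂ t) (abs_le.1 ((hR₂ t ht).trans (le_max_right _ _)))
    rw [Real.dist_eq, Real.dist_eq] at hlipK
    calc |r t| ≤ |p * w t| + |y₁ t ^ p - y₂ t ^ p| + |m ^ 2 * exp (2 * m * t) * w t| :=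
          (abs_add_le _ _).trans (by gcongr; exact abs_sub _ _)
      _ ≤ p * |w t| + K * |w t| + m ^ 2 * exp (2 * m * T) * |w t| := by
          rw [abs_mul, abs_of_pos (show 0 < p by linarith), abs_mul (m ^ 2 * exp (2 * m * t)),
            abs_of_pos (show 0 < m ^ 2 * exp (2 * m * t) by positivity)]
          gcongr
          exact ht.2
      _ = _ := by ring
  obtain ⟨hw0, hv0⟩ := hleft T₀ self_mem_Iic
  have hright := eq_zero_of_initial_zero hα (fun t ht => (hw t (hsub' ht)).mono hsub')
    (fun t ht => (hv t (hsub' ht)).mono hsub') hr₁ hw0 hv0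
  intro t ht
  rcases le_total t T₀ with h | h
  · exact sub_eq_zero.1 (hleft t h).1
  · exact sub_eq_zero.1 (hright t ⟨h, ht⟩)

theorem mConst_pos_and_alphaConst_pos {N : ℕ} (hN : 3 ≤ N) {p : ℝ} (hp : 1 < p)
    (hpS : pSob N < p) : 0 < mConst N p ∧ 0 < alphaConst N p := by
  have hN' : (3 : ℝ) ≤ N := by exact_mod_cast hN
  have hθ : 0 < thetaP p := div_pos two_pos (by linarith)
  have hθN : 2 * thetaP p < (N : ℝ) - 2 := by
    rw [pSob, div_lt_iff₀ (by linarith)] at hpS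
    rw [thetaP, ← mul_div_assoc, div_lt_iff₀ (by linarith)]
    linarith
  have hm : 0 < mConst N p := Real.rpow_pos_of_pos (mul_pos hθ (by linarith)) _
  exact ⟨hm, mul_pos hm (by linarith)⟩

/-- existence and uniqueness of the singular solution `y*` of
`y'' + α y' - y + y^p - m² e^{2mt} y = 0` with `y → 1` as `t → -∞`. -/
theorem singular_solution_exists_unique (N : ℕ) (hN : 3 ≤ N) (p : ℝ) (hp : 1 < p)
    (hpS : pSob N < p) :
    (∃ T : ℝ, ∃ y y' y'' : ℝ → ℝ, IsSingODEOn N p T y y' y'') ∧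
    (∀ T₁ T₂ : ℝ, ∀ y₁ y₁' y₁'' y₂ y₂' y₂'' : ℝ → ℝ,
      IsSingODEOn N p T₁ y₁ y₁' y₁'' → IsSingODEOn N p T₂ y₂ y₂' y₂'' →
      EqOn y₁ y₂ (Iic (min T₁ T₂))) := by
  obtain ⟨hm, hα⟩ := mConst_pos_and_alphaConst_pos hN hp hpS
  refine ⟨?_, ?_⟩
  · obtain ⟨T, y, y', y'', h, h', hc, he, hl⟩ := exists_singular_solution hα hm hp
    exact ⟨T, y, y', y'', fun t _ => (h t).hasDerivWithinAt, fun t _ => (h' t).hasDerivWithinAt,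
      hc.continuousOn, he, hl⟩
  · rintro T₁ T₂ y₁ y₁' y₁'' y₂ y₂' y₂'' ⟨h₁, h₁', -, e₁, l₁⟩ ⟨h₂, h₂', -, e₂, l₂⟩
    have s₁ : Iic (min T₁ T₂) ⊆ Iic T₁ := Iic_subset_Iic.2 (min_le_left _ _)
    have s₂ : Iic (min T₁ T₂) ⊆ Iic T₂ := Iic_subset_Iic.2 (min_le_right _ _)
    exact eqOn_of_singular_solutions hα hm hp
      (fun t ht => (h₁ t (s₁ ht)).mono s₁) (fun t ht => (h₁' t (s₁ ht)).mono s₁)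
      (fun t ht => e₁ t (s₁ ht)) l₁
      (fun t ht => (h₂ t (s₂ ht)).mono s₂) (fun t ht => (h₂' t (s₂ ht)).mono s₂)
      (fun t ht => e₂ t (s₂ ht)) l₂
end
end

section
/- Suppose p > p_S and let y ∈ C²((−∞,T]) satisfy y''(t) + α y'(t) − y(t) + y(t)^p − m² e^{2mt} y(t) = 0 for t ≤ T with y(t) → 1 as t → −∞. Then y extends to a solution y* ∈ C²(ℝ) of the same equation on all of ℝ, and for every t ∈ ℝ one has 0 < y*(t) ≤ ((p+1)(1 + m² e^{2mt})/2)^{1/(p−1)}. Consequently the function u*(s) := A s^{−θ} y*(m^{−1} log s) is positive on (0,∞) and satisfies (u*)''(s) + ((N−1)/s)(u*)'(s) + f(u*(s)) = 0 for all s > 0. -/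
open Real Set Filter Topology MeasureTheory

noncomputable section

theorem exists_solution_Icc_of_lipschitzWith_of_bounded {E : Type*} [NormedAddCommGroup E]
    [NormedSpace ℝ E] [CompleteSpace E] {F : ℝ → E → E} {t₀ t₁ : ℝ} (ht : t₀ ≤ t₁) (x₀ : E)
    {K L : NNReal} (hlip : ∀ t ∈ Icc t₀ t₁, LipschitzWith K (F t))
    (hcont : ∀ x, ContinuousOn (fun t => F t x) (Icc t₀ t₁))
    (hbound : ∀ t ∈ Icc t₀ t₁, ∀ x, ‖F t x‖ ≤ L) :
    ∃ x : ℝ → E, x t₀ = x₀ ∧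
      ∀ t ∈ Icc t₀ t₁, HasDerivWithinAt x (F t (x t)) (Icc t₀ t₁) t := by
  have hP : IsPicardLindelof F (⟨t₀, left_mem_Icc.2 ht⟩ : Icc t₀ t₁) x₀
      (L * (t₁ - t₀).toNNReal) 0 L K :=
    { lipschitzOnWith := fun t h => (hlip t h).lipschitzOnWith
      continuousOn := fun x _ => hcont x
      norm_le := fun t h x _ => hbound t h x
      mul_max_le := by simp [ht] }
  exact hP.exists_eq_forall_mem_Icc_hasDerivWithinAt₀

/-- The energy `z²/2 - c y²/2 + y^{p+1}/(p+1)` of `y'' + a y' - c y + y^p = 0`, with `z = y'`. -/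
def dampedEnergy (c p y z : ℝ) : ℝ :=
  z ^ 2 / 2 - c * y ^ 2 / 2 + y ^ (p + 1) / (p + 1)

/-- `(y, z)` solves the first order system of `y'' + a y' - c y + y^p = 0` on `S`. -/
def IsDampedSolOn (a p : ℝ) (c : ℝ → ℝ) (S : Set ℝ) (y z : ℝ → ℝ) : Prop :=
  (∀ t ∈ S, HasDerivWithinAt y (z t) S t) ∧
  ∀ t ∈ S, HasDerivWithinAt z (-a * z t + c t * y t - y t ^ p) S t

theorem IsDampedSolOn.congr {a p : ℝ} {c : ℝ → ℝ} {S : Set ℝ} {y z y₁ z₁ : ℝ → ℝ}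
    (h : IsDampedSolOn a p c S y z) (hy : EqOn y₁ y S) (hz : EqOn z₁ z S) :
    IsDampedSolOn a p c S y₁ z₁ := by
  refine ⟨fun t ht => ?_, fun t ht => ?_⟩
  · rw [hz ht]
    exact (h.1 t ht).congr hy (hy ht)
  · rw [hz ht, hy ht]
    exact (h.2 t ht).congr hz (hz ht)

theorem IsDampedSolOn.antitoneOn_energy {a p : ℝ} {c c' : ℝ → ℝ} {S : Set ℝ} {y z : ℝ → ℝ}
    (h : IsDampedSolOn a p c S y z) (hS : Convex ℝ S) (hp : 0 < p) (ha : 0 ≤ a)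
    (hc : ∀ t, HasDerivAt c (c' t) t) (hc' : ∀ t, 0 ≤ c' t) :
    AntitoneOn (fun t => dampedEnergy (c t) p (y t) (z t)) S := by
  have key : ∀ t ∈ S, HasDerivWithinAt (fun t => dampedEnergy (c t) p (y t) (z t))
      (-a * z t ^ 2 - c' t * y t ^ 2 / 2) S t := by
    intro t ht
    have hy := h.1 t ht
    have hz := h.2 t ht
    have h1 := (hz.pow 2).div_const 2
    have h2 := ((hc t).hasDerivWithinAt.mul (hy.pow 2)).div_const 2 (s := S)
    have h3 := (hy.rpow_const (p := p + 1) (Or.inr (by linarith))).div_const (p + 1)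
    have hp1 : p + 1 ≠ 0 := by positivity
    refine ((h1.sub h2).add h3).congr_deriv ?_
    simp only [add_sub_cancel_right]
    field_simp
    simp
    ring
  refine antitoneOn_of_deriv_nonpos hS (fun t ht => (key t ht).continuousWithinAt)
    (fun t ht => ((key t (interior_subset ht)).mono interior_subset).differentiableWithinAt)
    fun t ht => ?_
  rw [((key t (interior_subset ht)).hasDerivAt (mem_interior_iff_mem_nhds.1 ht)).deriv]
  have := hc' t
  nlinarith [mul_nonneg ha (sq_nonneg (z t)), mul_nonneg this (sq_nonneg (y t))]

theorem ne_zero_of_dampedEnergy_neg {c p y z : ℝ} (hp : 0 < p) (h : dampedEnergy c p y z < 0) :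
    y ≠ 0 := by
  rintro rfl
  rw [dampedEnergy, zero_rpow (by positivity)] at h
  simp only [zero_div] at h
  nlinarith [sq_nonneg z]

theorem rpow_lt_and_sq_lt_of_dampedEnergy_neg {c p y z : ℝ} (hp : 1 < p) (hy : 0 < y)
    (h : dampedEnergy c p y z < 0) :
    y < ((p + 1) * c / 2) ^ (1 / (p - 1)) ∧ z ^ 2 < c * y ^ 2 := by
  have hpow : y ^ (p + 1) = y ^ (p - 1) * y ^ 2 := by
    rw [← rpow_natCast, ← rpow_add hy]
    norm_num
    ring_nf
  have hpos : 0 < y ^ (p - 1) := rpow_pos_of_pos hy _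
  have hp1 : 0 < p + 1 := by linarith
  rw [dampedEnergy] at h
  have hfrac : 0 < y ^ (p + 1) / (p + 1) := div_pos (rpow_pos_of_pos hy _) hp1
  refine ⟨?_, by nlinarith⟩
  have hlt : y ^ (p - 1) < (p + 1) * c / 2 := by
    have h1 : y ^ (p + 1) / (p + 1) < c * y ^ 2 / 2 := by nlinarith [sq_nonneg z]
    rw [div_lt_iff₀ hp1, hpow] at h1
    have h2 : 0 < y ^ 2 := by positivity
    by_contra! hge
    nlinarith [mul_le_mul_of_nonneg_right hge h2.le]
  calc y = (y ^ (p - 1)) ^ (1 / (p - 1)) := by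
        rw [← rpow_mul hy.le, mul_one_div_cancel (by linarith), rpow_one]
    _ < _ := rpow_lt_rpow hpos.le hlt (by apply one_div_pos.2; linarith)

theorem abs_rpow_sub_rpow_le {p M x y : ℝ} (hp : 1 ≤ p) (hx : x ∈ Icc 0 M) (hy : y ∈ Icc 0 M) :
    |x ^ p - y ^ p| ≤ p * M ^ (p - 1) * |x - y| := by
  refine Convex.norm_image_sub_le_of_norm_hasDerivWithin_le (𝕜 := ℝ) (f := fun x => x ^ p)
    (f' := fun x => p * x ^ (p - 1))
    (fun u _ => (hasDerivAt_rpow_const (Or.inr hp)).hasDerivWithinAt) (fun u hu => ?_)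
    (convex_Icc 0 M) hy hx
  rw [norm_of_nonneg (mul_nonneg (by linarith) (rpow_nonneg hu.1 _))]
  exact mul_le_mul_of_nonneg_left (rpow_le_rpow hu.1 hu.2 (by linarith)) (by linarith)

theorem exists_truncated_solution {a p M C : ℝ} {c : ℝ → ℝ} {t₀ t₁ : ℝ} (ht : t₀ ≤ t₁)
    (hp : 1 ≤ p) (hM : 0 ≤ M) (hc : ContinuousOn c (Icc t₀ t₁))
    (hC : ∀ t ∈ Icc t₀ t₁, |c t| ≤ C) (y₀ z₀ : ℝ) :
    ∃ y z : ℝ → ℝ, y t₀ = y₀ ∧ z t₀ = z₀ ∧ ∀ t ∈ Icc t₀ t₁,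
      HasDerivWithinAt y (max (-M) (min M (z t))) (Icc t₀ t₁) t ∧
      HasDerivWithinAt z (-a * max (-M) (min M (z t)) + c t * max 0 (min M (y t))
        - max 0 (min M (y t)) ^ p) (Icc t₀ t₁) t := by
  set φ : ℝ → ℝ := fun y => max 0 (min M y)
  set ψ : ℝ → ℝ := fun z => max (-M) (min M z)
  have hφ : ∀ y, φ y ∈ Icc 0 M := fun y => ⟨le_max_left _ _, max_le hM (min_le_left _ _)⟩
  have hψ : ∀ z, |ψ z| ≤ M := fun z =>
    abs_le.2 ⟨le_max_left _ _, max_le (by linarith) (min_le_left _ _)⟩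
  have hφl : ∀ x y, |φ x - φ y| ≤ |x - y| := fun x y => by
    simpa [Real.dist_eq] using ((LipschitzWith.id.const_min M).const_max 0).dist_le_mul x y
  have hψl : ∀ x y, |ψ x - ψ y| ≤ |x - y| := fun x y => by
    simpa [Real.dist_eq] using ((LipschitzWith.id.const_min M).const_max (-M)).dist_le_mul x y
  have hC0 : 0 ≤ C := (abs_nonneg _).trans (hC t₀ (left_mem_Icc.2 ht))
  have hD0 : 0 ≤ p * M ^ (p - 1) := mul_nonneg (by linarith) (rpow_nonneg hM _)
  have hMp : 0 ≤ M ^ p := rpow_nonneg hM _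
  obtain ⟨x, hx0, hx⟩ := exists_solution_Icc_of_lipschitzWith_of_bounded
    (F := fun t (x : ℝ × ℝ) => (ψ x.2, -a * ψ x.2 + c t * φ x.1 - φ x.1 ^ p)) ht (y₀, z₀)
    (K := (1 + |a| + C + p * M ^ (p - 1)).toNNReal) (L := (M + |a| * M + C * M + M ^ p).toNNReal)
    (fun t h => LipschitzWith.of_dist_le_mul fun u v => by
      rw [coe_toNNReal _ (by positivity), Prod.dist_eq]
      have h1 : |u.1 - v.1| ≤ dist u v := le_max_left (dist u.1 v.1) (dist u.2 v.2)
      have h2 : |u.2 - v.2| ≤ dist u v := le_max_right (dist u.1 v.1) (dist u.2 v.2)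
      have hd : 0 ≤ dist u v := dist_nonneg
      have e1 := (hψl u.2 v.2).trans h2
      have e2 := (hφl u.1 v.1).trans h1
      have e3 : |φ u.1 ^ p - φ v.1 ^ p| ≤ p * M ^ (p - 1) * dist u v :=
        (abs_rpow_sub_rpow_le hp (hφ _) (hφ _)).trans (mul_le_mul_of_nonneg_left e2 hD0)
      have e4 : |a * (ψ u.2 - ψ v.2)| ≤ |a| * dist u v := by
        rw [abs_mul]; exact mul_le_mul_of_nonneg_left e1 (abs_nonneg _)
      have e5 : |c t * (φ u.1 - φ v.1)| ≤ C * dist u v := by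
        rw [abs_mul]; exact mul_le_mul (hC t h) e2 (abs_nonneg _) hC0
      have e6 : 0 ≤ |a| * dist u v := by positivity
      have e7 : 0 ≤ C * dist u v := by positivity
      have e8 : 0 ≤ p * M ^ (p - 1) * dist u v := by positivity
      rw [abs_le] at e3 e4 e5
      refine max_le ?_ ?_
      · rw [Real.dist_eq]
        linarith
      · rw [Real.dist_eq, abs_le]
        constructor <;> linarith [e3.1, e3.2, e4.1, e4.2, e5.1, e5.2])
    (fun x => by fun_prop)
    (fun t h x => by
      rw [coe_toNNReal _ (by positivity), Prod.norm_def]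
      have e1 := hψ x.2
      have e2 := hφ x.1
      have e4 : |a * ψ x.2| ≤ |a| * M := by
        rw [abs_mul]; exact mul_le_mul_of_nonneg_left e1 (abs_nonneg _)
      have e5 : |c t * φ x.1| ≤ C * M := by
        rw [abs_mul, abs_of_nonneg e2.1]; exact mul_le_mul (hC t h) e2.2 e2.1 hC0
      have e3 : φ x.1 ^ p ≤ M ^ p := rpow_le_rpow e2.1 e2.2 (by linarith)
      have e3' : 0 ≤ φ x.1 ^ p := rpow_nonneg e2.1 _
      have e6 : 0 ≤ |a| * M := by positivity
      have e7 : 0 ≤ C * M := by positivity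
      rw [abs_le] at e4 e5
      refine max_le ?_ ?_
      · rw [Real.norm_eq_abs]
        linarith
      · rw [Real.norm_eq_abs, abs_le]
        constructor <;> linarith [e4.1, e4.2, e5.1, e5.2])
  exact ⟨fun t => (x t).1, fun t => (x t).2, by simp [hx0], by simp [hx0], fun t h =>
    ⟨(hasFDerivAt_fst.comp_hasDerivWithinAt t (hx t h) :),
      (hasFDerivAt_snd.comp_hasDerivWithinAt t (hx t h) :)⟩⟩

theorem IsDampedSolOn.energy_lt_zero {a p : ℝ} {c c' : ℝ → ℝ} {S : Set ℝ} {y z : ℝ → ℝ}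
    (h : IsDampedSolOn a p c S y z) (hS : Convex ℝ S) (hp : 0 < p) (ha : 0 ≤ a)
    (hc : ∀ t, HasDerivAt c (c' t) t) (hc' : ∀ t, 0 ≤ c' t) {t₀ t : ℝ} (ht₀ : t₀ ∈ S)
    (ht : t ∈ S) (hle : t₀ ≤ t) (hE : dampedEnergy (c t₀) p (y t₀) (z t₀) < 0) :
    dampedEnergy (c t) p (y t) (z t) < 0 :=
  (h.antitoneOn_energy hS hp ha hc hc' ht₀ ht hle).trans_lt hE

theorem exists_solution_Icc_of_energy_neg {a p : ℝ} {c c' : ℝ → ℝ} {t₀ t₁ : ℝ} (ht : t₀ ≤ t₁)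
    (hp : 1 < p) (ha : 0 ≤ a) (hc : ∀ t, HasDerivAt c (c' t) t) (hc' : ∀ t, 0 ≤ c' t)
    (hc0 : ∀ t, 0 ≤ c t) {y₀ z₀ : ℝ} (hy₀ : 0 < y₀) (hE : dampedEnergy (c t₀) p y₀ z₀ < 0) :
    ∃ y z : ℝ → ℝ, y t₀ = y₀ ∧ z t₀ = z₀ ∧ IsDampedSolOn a p c (Icc t₀ t₁) y z := by
  have hmono : Monotone c :=
    monotone_of_deriv_nonneg (fun t => (hc t).differentiableAt) fun t => by
      rw [(hc t).deriv]; exact hc' t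
  have hcont : Continuous c := continuous_iff_continuousAt.2 fun t => (hc t).continuousAt
  set B : ℝ := ((p + 1) * c t₁ / 2) ^ (1 / (p - 1)) with hB
  have hC0 := hc0 t₁
  have hB0 : 0 ≤ B := rpow_nonneg (by positivity) _
  set M : ℝ := (1 + c t₁) * B + 1 with hM
  have hM0 : 0 ≤ M := by positivity
  have hbd : ∀ t ≤ t₁, ∀ y z : ℝ, 0 ≤ y → dampedEnergy (c t) p y z < 0 →
      0 < y ∧ y < M ∧ |z| < M := by
    intro t htt y z hy hneg
    have hy0 : 0 < y := lt_of_le_of_ne hy (ne_zero_of_dampedEnergy_neg (by linarith) hneg).symm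
    obtain ⟨h1, h2⟩ := rpow_lt_and_sq_lt_of_dampedEnergy_neg hp hy0 hneg
    have h3 : y < B := h1.trans_le <| rpow_le_rpow (by have := hc0 t; positivity)
      (by have := hmono htt; gcongr) (by apply one_div_nonneg.2; linarith)
    refine ⟨hy0, by nlinarith, ?_⟩
    have h4 : z ^ 2 < ((1 + c t₁) * B) ^ 2 := by
      calc z ^ 2 < c t * y ^ 2 := h2
        _ ≤ (1 + c t₁) ^ 2 * B ^ 2 := by
          have := hmono htt
          have := hc0 t
          gcongr
          nlinarith
        _ = _ := by ring
    have h5 := abs_lt_of_sq_lt_sq h4 (by positivity)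
    linarith
  obtain ⟨y, z, hy, hz, hyz⟩ := exists_truncated_solution (a := a) (C := c t₁) ht hp.le hM0
    hcont.continuousOn (fun t h => by rw [abs_of_nonneg (hc0 t)]; exact hmono h.2) y₀ z₀
  have hsol : ∀ s ∈ Icc t₀ t₁, (∀ t ∈ Icc t₀ s, y t ∈ Icc 0 M ∧ z t ∈ Icc (-M) M) →
      IsDampedSolOn a p c (Icc t₀ s) y z := by
    intro s hs hin
    have hsub : Icc t₀ s ⊆ Icc t₀ t₁ := Icc_subset_Icc_right hs.2
    refine ⟨fun t h => ?_, fun t h => ?_⟩ <;> obtain ⟨h1, h2⟩ := hin t h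
    · simpa [h2.1, h2.2] using ((hyz t (hsub h)).1).mono hsub
    · simpa [h1.1, h1.2, h2.1, h2.2] using ((hyz t (hsub h)).2).mono hsub
  have hyc : ContinuousOn y (Icc t₀ t₁) := fun t h => (hyz t h).1.continuousWithinAt
  have hzc : ContinuousOn z (Icc t₀ t₁) := fun t h => (hyz t h).2.continuousWithinAt
  have hgood : ∀ t ∈ Icc t₀ t₁, 0 < y t ∧ y t < M ∧ |z t| < M := by
    by_contra! hcon
    set G : Set (ℝ × ℝ) := {w | 0 < w.1 ∧ w.1 < M ∧ |w.2| < M} with hG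
    have hGo : IsOpen G :=
      (isOpen_lt continuous_const continuous_fst).inter
        ((isOpen_lt continuous_fst continuous_const).inter
          (isOpen_lt continuous_snd.abs continuous_const))
    have hbad : IsCompact (Icc t₀ t₁ ∩ (fun t => (y t, z t)) ⁻¹' Gᶜ) :=
      isCompact_Icc.of_isClosed_subset
        ((hyc.prodMk hzc).preimage_isClosed_of_isClosed isClosed_Icc hGo.isClosed_compl)
        inter_subset_left
    obtain ⟨r, hr, hrb⟩ := hcon
    obtain ⟨s, ⟨hs, hsbad⟩, hleast⟩ := hbad.exists_isLeast ⟨r, hr, fun h => by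
      have := hrb h.1 h.2.1
      exact absurd h.2.2 (not_lt.2 this)⟩
    have hpre : ∀ t ∈ Ico t₀ s, (y t, z t) ∈ G := by
      intro t h
      by_contra hn
      exact absurd (hleast ⟨⟨h.1, h.2.le.trans hs.2⟩, hn⟩) (not_le.2 h.2)
    have hts : t₀ < s := by
      refine lt_of_le_of_ne hs.1 ?_
      rintro rfl
      refine hsbad ?_
      show 0 < y t₀ ∧ y t₀ < M ∧ |z t₀| < M
      rw [hy, hz]
      exact hbd t₀ ht y₀ z₀ hy₀.le hE
    have hcl := closure_Ico hts.ne
    have hsub : Icc t₀ s ⊆ Icc t₀ t₁ := Icc_subset_Icc_right hs.2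
    have hmapy : MapsTo y (Icc t₀ s) (Icc 0 M) := by
      have : MapsTo y (Ico t₀ s) (Icc 0 M) := fun t h => ⟨(hpre t h).1.le, (hpre t h).2.1.le⟩
      simpa [hcl] using this.closure_of_continuousOn (by rw [hcl]; exact hyc.mono hsub)
    have hmapz : MapsTo z (Icc t₀ s) (Icc (-M) M) := by
      have : MapsTo z (Ico t₀ s) (Icc (-M) M) := fun t h => abs_le.1 (hpre t h).2.2.le
      simpa [hcl] using this.closure_of_continuousOn (by rw [hcl]; exact hzc.mono hsub)
    have hd := hsol s hs fun t h => ⟨hmapy h, hmapz h⟩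
    have hEs := hd.energy_lt_zero (convex_Icc _ _) (by linarith) ha hc hc'
      (left_mem_Icc.2 hts.le) (right_mem_Icc.2 hts.le) hts.le (by rwa [hy, hz])
    exact hsbad (hbd s hs.2 _ _ (hmapy (right_mem_Icc.2 hts.le)).1 hEs)
  exact ⟨y, z, hy, hz, hsol t₁ (right_mem_Icc.2 ht) fun t h =>
    ⟨⟨(hgood t h).1.le, (hgood t h).2.1.le⟩, abs_le.1 (hgood t h).2.2.le⟩⟩

theorem IsDampedSolOn.exists_extend_Iic {a p T T' : ℝ} {c c' : ℝ → ℝ} {y z : ℝ → ℝ}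
    (h : IsDampedSolOn a p c (Iic T) y z) (hT : T ≤ T')
    (hp : 1 < p) (ha : 0 ≤ a) (hc : ∀ t, HasDerivAt c (c' t) t) (hc' : ∀ t, 0 ≤ c' t)
    (hc0 : ∀ t, 0 ≤ c t) (hy : 0 < y T) (hE : dampedEnergy (c T) p (y T) (z T) < 0) :
    ∃ y₁ z₁ : ℝ → ℝ, IsDampedSolOn a p c (Iic T') y₁ z₁ ∧
      EqOn y₁ y (Iic T) ∧ EqOn z₁ z (Iic T) := by
  obtain ⟨u, v, hu, hv, huv⟩ := exists_solution_Icc_of_energy_neg hT hp ha hc hc' hc0 hy hE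
  set y₁ : ℝ → ℝ := fun t => if t ≤ T then y t else u t
  set z₁ : ℝ → ℝ := fun t => if t ≤ T then z t else v t
  have hy1 : EqOn y₁ y (Iic T) := fun t ht => if_pos ht
  have hz1 : EqOn z₁ z (Iic T) := fun t ht => if_pos ht
  have hu1 : EqOn y₁ u (Icc T T') := fun t ht => by
    rcases ht.1.eq_or_lt with rfl | hlt
    · simp [y₁, hu]
    · simp [y₁, not_le.2 hlt]
  have hv1 : EqOn z₁ v (Icc T T') := fun t ht => by
    rcases ht.1.eq_or_lt with rfl | hlt
    · simp [z₁, hv]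
    · simp [z₁, not_le.2 hlt]
  have hl := h.congr hy1 hz1
  have hr := huv.congr hu1 hv1
  have glue : ∀ {w w' : ℝ → ℝ}, (∀ t ∈ Iic T, HasDerivWithinAt w (w' t) (Iic T) t) →
      (∀ t ∈ Icc T T', HasDerivWithinAt w (w' t) (Icc T T') t) →
      ∀ t ∈ Iic T', HasDerivWithinAt w (w' t) (Iic T') t := by
    intro w w' h1 h2 t ht
    rw [← Iic_union_Icc_eq_Iic hT]
    refine HasDerivWithinAt.union ?_ ?_
    · by_cases hm : t ∈ Iic T
      · exact h1 t hm
      · exact hasDerivWithinAt_iff_hasFDerivWithinAt.2 <|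
          .of_notMem_closure (by rwa [isClosed_Iic.closure_eq])
    · by_cases hm : t ∈ Icc T T'
      · exact h2 t hm
      · exact hasDerivWithinAt_iff_hasFDerivWithinAt.2 <|
          .of_notMem_closure (by rwa [isClosed_Icc.closure_eq])
  exact ⟨y₁, z₁, ⟨glue hl.1 hr.1, glue hl.2 hr.2⟩, hy1, hz1⟩

theorem IsDampedSolOn.pos_of_energy_lt_zero {a p T : ℝ} {c : ℝ → ℝ} {y z : ℝ → ℝ}
    (h : IsDampedSolOn a p c (Iic T) y z) (hp : 0 < p)
    (hE : ∀ t ∈ Iic T, dampedEnergy (c t) p (y t) (z t) < 0) {t₀ : ℝ} (ht₀ : t₀ ∈ Iic T)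
    (hy : 0 < y t₀) : ∀ t ∈ Iic T, 0 < y t := by
  intro t ht
  by_contra! hle
  have hcont : ContinuousOn y (Iic T) := fun s hs => (h.1 s hs).continuousWithinAt
  obtain ⟨s, hs, hs0⟩ := (convex_Iic T).isPreconnected.intermediate_value ht ht₀ hcont
    (show (0 : ℝ) ∈ Icc (y t) (y t₀) from ⟨hle, hy.le⟩)
  exact ne_zero_of_dampedEnergy_neg hp (hE s hs) hs0

theorem IsDampedSolOn.exists_extend_univ {a p T : ℝ} {c c' : ℝ → ℝ} {y z : ℝ → ℝ}
    (h : IsDampedSolOn a p c (Iic T) y z)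
    (hp : 1 < p) (ha : 0 ≤ a) (hc : ∀ t, HasDerivAt c (c' t) t) (hc' : ∀ t, 0 ≤ c' t)
    (hc0 : ∀ t, 0 ≤ c t) (hy : ∀ t ∈ Iic T, 0 < y t)
    (hE : ∀ t ∈ Iic T, dampedEnergy (c t) p (y t) (z t) < 0) :
    ∃ y₁ z₁ : ℝ → ℝ, IsDampedSolOn a p c univ y₁ z₁ ∧ EqOn y₁ y (Iic T) ∧
      ∀ t, 0 < y₁ t ∧ dampedEnergy (c t) p (y₁ t) (z₁ t) < 0 := by
  have hp0 : 0 < p := by linarith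
  have step : ∀ (n : ℕ) (w : (ℝ → ℝ) × (ℝ → ℝ)), ∃ w' : (ℝ → ℝ) × (ℝ → ℝ),
      (IsDampedSolOn a p c (Iic (T + n)) w.1 w.2 ∧ ∀ t ∈ Iic (T + n),
        0 < w.1 t ∧ dampedEnergy (c t) p (w.1 t) (w.2 t) < 0) →
      (IsDampedSolOn a p c (Iic (T + (n + 1 : ℕ))) w'.1 w'.2 ∧ ∀ t ∈ Iic (T + (n + 1 : ℕ)),
        0 < w'.1 t ∧ dampedEnergy (c t) p (w'.1 t) (w'.2 t) < 0) ∧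
      EqOn w'.1 w.1 (Iic (T + n)) ∧ EqOn w'.2 w.2 (Iic (T + n)) := by
    intro n w
    by_cases hw : IsDampedSolOn a p c (Iic (T + n)) w.1 w.2 ∧ ∀ t ∈ Iic (T + n),
        0 < w.1 t ∧ dampedEnergy (c t) p (w.1 t) (w.2 t) < 0
    swap
    · exact ⟨w, fun hw' => absurd hw' hw⟩
    have hTn : T + n ∈ Iic (T + n) := self_mem_Iic
    have hle : T + (n : ℝ) ≤ T + (n + 1 : ℕ) := by push_cast; linarith
    obtain ⟨u, v, huv, hu, hv⟩ := hw.1.exists_extend_Iic hle hp ha hc hc' hc0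
      (hw.2 _ hTn).1 (hw.2 _ hTn).2
    have hneg : ∀ t ∈ Iic (T + (n + 1 : ℕ)), dampedEnergy (c t) p (u t) (v t) < 0 := by
      intro t ht
      rcases le_total t (T + n) with h1 | h1
      · rw [hu h1, hv h1]
        exact (hw.2 t h1).2
      · refine huv.energy_lt_zero (convex_Iic _) hp0 ha hc hc' (t₀ := T + n) hle ht h1 ?_
        rw [hu hTn, hv hTn]
        exact (hw.2 _ hTn).2
    have hpos := huv.pos_of_energy_lt_zero hp0 hneg (t₀ := T + n) hle
      (by rw [hu hTn]; exact (hw.2 _ hTn).1)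
    exact ⟨(u, v), fun _ => ⟨⟨huv, fun t ht => ⟨hpos t ht, hneg t ht⟩⟩, hu, hv⟩⟩
  choose succSol hsucc using step
  let w : ℕ → (ℝ → ℝ) × (ℝ → ℝ) := fun n => Nat.rec (y, z) succSol n
  have hw : ∀ n : ℕ, IsDampedSolOn a p c (Iic (T + n)) (w n).1 (w n).2 ∧ ∀ t ∈ Iic (T + n),
      0 < (w n).1 t ∧ dampedEnergy (c t) p ((w n).1 t) ((w n).2 t) < 0 := by
    intro n
    induction n with
    | zero => simpa [w] using And.intro h fun t ht => ⟨hy t ht, hE t ht⟩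
    | succ n ih => exact (hsucc n (w n) ih).1
  have hagree : ∀ n k : ℕ, EqOn (w (n + k)).1 (w n).1 (Iic (T + n)) ∧
      EqOn (w (n + k)).2 (w n).2 (Iic (T + n)) := by
    intro n k
    induction k with
    | zero => exact ⟨fun _ _ => rfl, fun _ _ => rfl⟩
    | succ k ih =>
      obtain ⟨-, h1, h2⟩ := hsucc (n + k) (w (n + k)) (hw (n + k))
      have hsub : Iic (T + (n : ℝ)) ⊆ Iic (T + ((n + k : ℕ) : ℝ)) :=
        Iic_subset_Iic.2 (by push_cast; linarith [k.cast_nonneg (α := ℝ)])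
      exact ⟨(h1.mono hsub).trans ih.1, (h2.mono hsub).trans ih.2⟩
  have hagree' : ∀ n k : ℕ, ∀ t ≤ T + n, t ≤ T + k →
      (w n).1 t = (w k).1 t ∧ (w n).2 t = (w k).2 t := by
    intro n k t hn hk
    rcases le_total n k with hnk | hnk <;> obtain ⟨j, rfl⟩ := Nat.exists_eq_add_of_le hnk
    · exact ⟨((hagree n j).1 hn).symm, ((hagree n j).2 hn).symm⟩
    · exact ⟨(hagree k j).1 hk, (hagree k j).2 hk⟩
  let idx : ℝ → ℕ := fun t => ⌈t - T⌉₊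
  have hidx : ∀ t, t ≤ T + idx t := fun t => by linarith [Nat.le_ceil (t - T)]
  have heq : ∀ n : ℕ, ∀ t ≤ T + n,
      (w (idx t)).1 t = (w n).1 t ∧ (w (idx t)).2 t = (w n).2 t :=
    fun n t ht => hagree' _ _ t (hidx t) ht
  refine ⟨fun t => (w (idx t)).1 t, fun t => (w (idx t)).2 t, ?_, fun t ht => ?_,
    fun t => (hw (idx t)).2 t (hidx t)⟩
  · have hnhds : ∀ t, Iic (T + (idx t + 1 : ℕ)) ∈ 𝓝 t := fun t =>
      Iic_mem_nhds (by push_cast; linarith [hidx t])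
    have hsol : ∀ n : ℕ, IsDampedSolOn a p c (Iic (T + n)) (fun t => (w (idx t)).1 t)
        (fun t => (w (idx t)).2 t) := fun n =>
      (hw n).1.congr (fun t ht => (heq n t ht).1) (fun t ht => (heq n t ht).2)
    exact ⟨fun t _ => (((hsol _).1 t (mem_of_mem_nhds (hnhds t))).hasDerivAt
        (hnhds t)).hasDerivWithinAt,
      fun t _ => (((hsol _).2 t (mem_of_mem_nhds (hnhds t))).hasDerivAt
        (hnhds t)).hasDerivWithinAt⟩
  · exact (heq 0 t (by simpa using ht)).1

theorem frequently_deriv_lt_of_tendsto_atBot {y z : ℝ → ℝ} {T l : ℝ}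
    (h : ∀ t ∈ Iic T, HasDerivWithinAt y (z t) (Iic T) t) (hy : Tendsto y atBot (𝓝 l))
    {ε : ℝ} (hε : 0 < ε) : ∃ᶠ t in atBot, |z t| < ε := by
  rw [frequently_atBot]
  intro b
  have hball := hy.eventually (Metric.ball_mem_nhds l (half_pos hε))
  obtain ⟨r, hr⟩ := eventually_atBot.1 hball
  set s := min r (min b T)
  have hsT : s ≤ T := (min_le_right _ _).trans (min_le_right _ _)
  obtain ⟨t, ht, hzt⟩ := exists_hasDerivAt_eq_slope y z (sub_one_lt s)
    (fun t ht => ((h t (ht.2.trans hsT)).continuousWithinAt).mono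
      fun _ hx => hx.2.trans hsT)
    (fun t ht => (h t (ht.2.le.trans hsT)).hasDerivAt (Iic_mem_nhds (ht.2.trans_le hsT)))
  refine ⟨t, ht.2.le.trans ((min_le_right _ _).trans (min_le_left _ _)), ?_⟩
  have h1 : |y s - l| < ε / 2 := hr s (min_le_left _ _)
  have h2 : |y (s - 1) - l| < ε / 2 := hr (s - 1) (by linarith [min_le_left r (min b T)])
  rw [hzt, sub_sub_cancel, div_one]
  rw [abs_lt] at *
  constructor <;> linarith [h1.1, h1.2, h2.1, h2.2]

theorem IsDampedSolOn.energy_lt_zero_of_tendsto {a p T : ℝ} {c c' : ℝ → ℝ} {y z : ℝ → ℝ}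
    (h : IsDampedSolOn a p c (Iic T) y z)
    (hp : 1 < p) (ha : 0 ≤ a) (hc : ∀ t, HasDerivAt c (c' t) t) (hc' : ∀ t, 0 ≤ c' t)
    (hclim : Tendsto c atBot (𝓝 1)) (hy : Tendsto y atBot (𝓝 1)) :
    ∀ t ∈ Iic T, dampedEnergy (c t) p (y t) (z t) < 0 := by
  have hlim : Tendsto (fun t => -(c t * y t ^ 2 / 2) + y t ^ (p + 1) / (p + 1)) atBot
      (𝓝 (-(1 * 1 ^ 2 / 2) + 1 ^ (p + 1) / (p + 1))) :=
    ((hclim.mul (hy.pow 2)).div_const 2).neg.add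
      ((hy.rpow_const (Or.inl one_ne_zero)).div_const _)
  obtain ⟨δ, hδ, hneg⟩ : ∃ δ > 0, -(1 * 1 ^ 2 / 2) + 1 ^ (p + 1) / (p + 1) < -δ := by
    refine ⟨(1 / 2 - 1 / (p + 1)) / 2, half_pos (sub_pos.2 ?_), ?_⟩ <;>
      have : 1 / (p + 1) < 1 / 2 := by
        apply one_div_lt_one_div_of_lt <;> linarith
    · exact this
    · rw [one_rpow]
      linarith
  intro t ht
  obtain ⟨s, hz, hs, hst⟩ := ((frequently_deriv_lt_of_tendsto_atBot h.1 hy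
    (sqrt_pos.2 hδ)).and_eventually ((hlim.eventually_lt_const hneg).and
      (eventually_le_atBot t))).exists
  refine h.energy_lt_zero (convex_Iic T) (by linarith) ha hc hc' (hst.trans ht) ht hst ?_
  have hz2 : z s ^ 2 < δ := by
    rw [← sq_abs]
    exact (lt_sqrt (abs_nonneg _)).1 hz
  rw [dampedEnergy]
  linarith

theorem hasDerivAt_rpow_mul_comp_log_div {A q m s : ℝ} {Y Z : ℝ → ℝ}
    (hY : ∀ t, HasDerivAt Y (Z t) t) (hs : 0 < s) :
    HasDerivAt (fun s => A * s ^ q * Y (log s / m))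
      (A * s ^ (q - 1) * (q * Y (log s / m) + Z (log s / m) / m)) s := by
  have h1 := (hasDerivAt_rpow_const (p := q) (Or.inl hs.ne')).const_mul A
  have h2 := (hY (log s / m)).comp s ((hasDerivAt_log hs.ne').div_const m)
  refine (h1.mul h2).congr_deriv ?_
  have : s ^ q = s ^ (q - 1) * s := by
    rw [← rpow_add_one hs.ne', sub_add_cancel]
  simp only [Function.comp_apply]
  rw [this]
  field_simp

theorem thetaP_mul_pos {N : ℕ} (hN : 3 ≤ N) {p : ℝ} (hp : 1 < p) (hpS : pSob N < p) :
    0 < thetaP p ∧ 0 < (N : ℝ) - 2 - 2 * thetaP p ∧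
      0 < thetaP p * ((N : ℝ) - 2 - thetaP p) := by
  have hN' : (3 : ℝ) ≤ N := by exact_mod_cast hN
  have hp1 : 0 < p - 1 := by linarith
  have hθ : 0 < thetaP p := div_pos two_pos hp1
  have h2 : 0 < (N : ℝ) - 2 - 2 * thetaP p := by
    rw [pSob, div_lt_iff₀ (by linarith)] at hpS
    have h3 : thetaP p * (p - 1) = 2 := div_mul_cancel₀ _ hp1.ne'
    by_contra! hcon
    nlinarith
  exact ⟨hθ, h2, mul_pos hθ (by linarith)⟩

theorem mConst_pos_and_sq {N : ℕ} {p : ℝ} (h : 0 < thetaP p * ((N : ℝ) - 2 - thetaP p)) :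
    0 < mConst N p ∧ mConst N p ^ 2 * (thetaP p * ((N : ℝ) - 2 - thetaP p)) = 1 := by
  refine ⟨rpow_pos_of_pos h _, ?_⟩
  rw [mConst, ← rpow_natCast, ← rpow_mul h.le]
  norm_num
  rw [rpow_neg_one, inv_mul_cancel₀ h.ne']

theorem ustar_eq_zero_of_dampedSol {N : ℕ} (hN : 3 ≤ N) {p : ℝ} (hp : 1 < p)
    (hpS : pSob N < p) {y z : ℝ → ℝ} (hy : ∀ t, HasDerivAt y (z t) t)
    (hz : ∀ t, HasDerivAt z (-alphaConst N p * z t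
      + (1 + mConst N p ^ 2 * exp (2 * mConst N p * t)) * y t - y t ^ p) t)
    (hpos : ∀ t, 0 < y t) {s : ℝ} (hs : 0 < s) :
    deriv (deriv (ustar N p y)) s + ((N : ℝ) - 1) / s * deriv (ustar N p y) s
      + fNL p (ustar N p y s) = 0 := by
  obtain ⟨hθ, hθ2, hprod⟩ := thetaP_mul_pos hN hp hpS
  obtain ⟨hm, hm2⟩ := mConst_pos_and_sq hprod
  have hp1 : p - 1 ≠ 0 := by linarith
  have hA : 0 < Aconst N p := rpow_pos_of_pos hprod _
  have hAp : Aconst N p ^ p = Aconst N p * (thetaP p * ((N : ℝ) - 2 - thetaP p)) := by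
    have h1 : Aconst N p ^ (p - 1) = thetaP p * ((N : ℝ) - 2 - thetaP p) := by
      rw [Aconst, ← rpow_mul hprod.le, one_div_mul_cancel hp1, rpow_one]
    rw [← h1, ← rpow_one_add' hA.le (by linarith), add_sub_cancel]
  have hθp : thetaP p * p = thetaP p + 2 := by
    have : thetaP p * (p - 1) = 2 := div_mul_cancel₀ _ hp1
    linarith
  have hd1 : ∀ r > 0, HasDerivAt (ustar N p y) (Aconst N p * r ^ (-thetaP p - 1) *
      (-thetaP p * y (log r / mConst N p) + z (log r / mConst N p) / mConst N p)) r :=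
    fun r hr => hasDerivAt_rpow_mul_comp_log_div hy hr
  have hd2 := hasDerivAt_rpow_mul_comp_log_div (A := Aconst N p) (q := -thetaP p - 1)
    (m := mConst N p) (Y := fun t => -thetaP p * y t + z t / mConst N p)
    (fun t => ((hy t).const_mul (-thetaP p)).add ((hz t).div_const (mConst N p))) hs
  have hev : deriv (ustar N p y) =ᶠ[𝓝 s] fun r => Aconst N p * r ^ (-thetaP p - 1) *
      (-thetaP p * y (log r / mConst N p) + z (log r / mConst N p) / mConst N p) := by
    filter_upwards [Ioi_mem_nhds hs] with r hr using (hd1 r hr).deriv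
  rw [hev.deriv_eq, hd2.deriv, (hd1 s hs).deriv, fNL, ustar]
  set t := log s / mConst N p with ht
  have hexp : exp (2 * mConst N p * t) = s ^ 2 := by
    rw [ht, show 2 * mConst N p * (log s / mConst N p) = log s + log s by field_simp; ring,
      exp_add, exp_log hs, sq]
  have hyt := hpos t
  have hs0 : 0 < s ^ (-thetaP p - 1 - 1) := rpow_pos_of_pos hs _
  have e1 : s ^ (-thetaP p - 1) = s ^ (-thetaP p - 1 - 1) * s := by
    rw [← rpow_add_one hs.ne', sub_add_cancel]
  have e2 : s ^ (-thetaP p) = s ^ (-thetaP p - 1 - 1) * s ^ 2 := by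
    rw [sq, ← mul_assoc, ← e1, ← rpow_add_one hs.ne', sub_add_cancel]
  have e3 : (Aconst N p * s ^ (-thetaP p) * y t) ^ p =
      Aconst N p * (thetaP p * ((N : ℝ) - 2 - thetaP p)) * s ^ (-thetaP p - 1 - 1) * y t ^ p := by
    rw [mul_rpow (mul_pos hA (rpow_pos_of_pos hs _)).le hyt.le,
      mul_rpow hA.le (rpow_pos_of_pos hs _).le, hAp, ← rpow_mul hs.le]
    congr 3
    linarith
  have hθ' : thetaP p * ((N : ℝ) - 2 - thetaP p) = 1 / mConst N p ^ 2 := by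
    field_simp
    linarith
  rw [e3, e1, e2, hexp, alphaConst, hθ']
  have hθ'' : thetaP p * (N : ℝ) = 1 / mConst N p ^ 2 + thetaP p * (2 + thetaP p) := by
    linarith
  have key : (-thetaP p - 1) * (-thetaP p * y t) + ((N : ℝ) - 1) * (-thetaP p * y t)
      = -(1 / mConst N p ^ 2) * y t := by
    linear_combination (-y t) * hθ''
  have key2 : Aconst N p * s ^ (-thetaP p - 1 - 1) *
      ((-thetaP p - 1) * (-thetaP p * y t) + ((N : ℝ) - 1) * (-thetaP p * y t)
      - (-(1 / mConst N p ^ 2) * y t)) = 0 := by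
    rw [key, sub_self, mul_zero]
  rw [← key2]
  field_simp
  ring

/-- the singular solution extends to a positive, bounded solution on all
of `ℝ`, and consequently `u*(s) = A s^{-θ} y*(m⁻¹ log s)` is a positive singular solution
of `u'' + ((N-1)/s)u' + f(u) = 0` on `(0,∞)`. -/
theorem singular_solution_extends (N : ℕ) (hN : 3 ≤ N) (p : ℝ) (hp : 1 < p)
    (hpS : pSob N < p)
    (T : ℝ) (y y' y'' : ℝ → ℝ) (hy : IsSingODEOn N p T y y' y'') :
    ∃ ys ys' ys'' : ℝ → ℝ,
      IsEntireSingODE N p ys ys' ys'' ∧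
      EqOn ys y (Iic T) ∧
      (∀ t : ℝ, 0 < ys t ∧
        ys t ≤ ((p + 1) * (1 + (mConst N p) ^ 2 * Real.exp (2 * mConst N p * t)) / 2)
          ^ (1 / (p - 1))) ∧
      (∀ s > (0:ℝ), 0 < ustar N p ys s) ∧
      (∀ s > (0:ℝ),
        deriv (deriv (ustar N p ys)) s + ((N : ℝ) - 1) / s * deriv (ustar N p ys) s
          + fNL p (ustar N p ys s) = 0) := by
  obtain ⟨hy1, hy2, -, hode, hlim⟩ := hy
  obtain ⟨hθ, hθ2, hprod⟩ := thetaP_mul_pos hN hp hpS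
  obtain ⟨hm, hm2⟩ := mConst_pos_and_sq hprod
  have hα : 0 ≤ alphaConst N p := (mul_pos hm hθ2).le
  have hp0 : 0 < p := by linarith
  set c : ℝ → ℝ := fun t => 1 + mConst N p ^ 2 * Real.exp (2 * mConst N p * t) with hc_def
  set c' : ℝ → ℝ := fun t =>
    mConst N p ^ 2 * (Real.exp (2 * mConst N p * t) * (2 * mConst N p)) with hc'_def
  have hc : ∀ t, HasDerivAt c (c' t) t := fun t => by
    have h := (((hasDerivAt_id t).const_mul (2 * mConst N p)).exp.const_mul
      (mConst N p ^ 2)).const_add 1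
    simpa [c, c'] using h
  have hc' : ∀ t, 0 ≤ c' t := fun t => by positivity
  have hc0 : ∀ t, 0 ≤ c t := fun t => by positivity
  have hclim : Tendsto c atBot (𝓝 1) := by
    have h := (((tendsto_exp_atBot.comp
      (tendsto_id.const_mul_atBot (show 0 < 2 * mConst N p by positivity))).const_mul
      (mConst N p ^ 2)).const_add 1)
    simpa [c, Function.comp_def] using h
  have hsol : IsDampedSolOn (alphaConst N p) p c (Iic T) y y' :=
    ⟨hy1, fun t ht => (hy2 t ht).congr_deriv (by linear_combination hode t ht)⟩
  have hE := hsol.energy_lt_zero_of_tendsto hp hα hc hc' hclim hlim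
  obtain ⟨t₀, ht₀T, ht₀⟩ :=
    ((eventually_le_atBot T).and (hlim.eventually_const_lt one_pos)).exists
  have hpos := hsol.pos_of_energy_lt_zero hp0 hE ht₀T ht₀
  obtain ⟨ys, zs, hs, heq, hbd⟩ := hsol.exists_extend_univ hp hα hc hc' hc0 hpos hE
  have hys : ∀ t, HasDerivAt ys (zs t) t := fun t => by simpa using hs.1 t (mem_univ t)
  have hzs : ∀ t, HasDerivAt zs (-alphaConst N p * zs t + c t * ys t - ys t ^ p) t :=
    fun t => by simpa using hs.2 t (mem_univ t)
  have hysc : Continuous ys := continuous_iff_continuousAt.2 fun t => (hys t).continuousAt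
  have hzsc : Continuous zs := continuous_iff_continuousAt.2 fun t => (hzs t).continuousAt
  have hcc : Continuous c := continuous_iff_continuousAt.2 fun t => (hc t).continuousAt
  refine ⟨ys, zs, fun t => -alphaConst N p * zs t + c t * ys t - ys t ^ p,
    ⟨hys, hzs, ?_, fun t => ?_, ?_⟩, heq, fun t => ⟨(hbd t).1, ?_⟩, fun s hs0 => ?_,
    fun s hs0 => ustar_eq_zero_of_dampedSol hN hp hpS hys hzs (fun t => (hbd t).1) hs0⟩
  · exact ((continuous_const.mul hzsc).add (hcc.mul hysc)).sub
      (hysc.rpow_const fun _ => Or.inr hp0.le)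
  · simp only [c]
    ring
  · exact hlim.congr' ((eventually_le_atBot T).mono fun t ht => (heq ht).symm)
  · exact (rpow_lt_and_sq_lt_of_dampedEnergy_neg hp (hbd t).1 (hbd t).2).1.le
  · exact mul_pos (mul_pos (rpow_pos_of_pos hprod _) (rpow_pos_of_pos hs0 _)) (hbd _).1
end
end

section
/- Suppose p_S < p < p_JL. Then there exists a strictly increasing sequence 0 < s₁* < s₂* < ··· of positive real numbers with s_n* → ∞ such that (u*)'(s_n*) = 0 for every n ≥ 1, (u*)'(s) < 0 for s ∈ (0, s₁*) and for s in each interval (s_{2k}*, s_{2k+1}*), (u*)'(s) > 0 for s in each interval (s_{2k−1}*, s_{2k}*), u*(s_n*) < 1 whenever n is odd, and u*(s_n*) > 1 whenever n is even; in particular u* has infinitely many positive critical points. -/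
open Real Set Filter Topology MeasureTheory

noncomputable section

theorem antitoneOn_Icc_of_hasDerivAt_nonpos {f f' : ℝ → ℝ} {a b : ℝ}
    (hf : ∀ x ∈ Icc a b, HasDerivAt f (f' x) x) (hf' : ∀ x ∈ Icc a b, f' x ≤ 0) :
    AntitoneOn f (Icc a b) := by
  refine antitoneOn_of_hasDerivWithinAt_nonpos (convex_Icc a b)
    (fun x hx => (hf x hx).continuousAt.continuousWithinAt)
    (fun x hx => (hf x (interior_subset hx)).hasDerivWithinAt)
    (fun x hx => hf' x (interior_subset hx))

/-- Sturm comparison with the sine: a positive function cannot satisfy `v'' ≤ -k² v` on a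
half-line. -/
theorem not_pos_of_deriv2_le_neg_sq_mul {v v1 v2 : ℝ → ℝ} {b k : ℝ} (hk : 0 < k)
    (h1 : ∀ s, b ≤ s → HasDerivAt v (v1 s) s) (h2 : ∀ s, b ≤ s → HasDerivAt v1 (v2 s) s)
    (hpos : ∀ s, b ≤ s → 0 < v s) (hle : ∀ s, b ≤ s → v2 s ≤ -k ^ 2 * v s) : False := by
  have hπ : 0 < π / k := by positivity
  have hanti : AntitoneOn
      (fun x => v1 x * Real.sin (k * (x - b)) - v x * (k * Real.cos (k * (x - b))))
      (Icc b (b + π / k)) := by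
    refine antitoneOn_Icc_of_hasDerivAt_nonpos
      (f' := fun x => (v2 x + k ^ 2 * v x) * Real.sin (k * (x - b))) ?_ ?_
    · intro x hx
      have hl : HasDerivAt (fun x => k * (x - b)) k x := by
        simpa using ((hasDerivAt_id x).sub_const b).const_mul k
      have := ((h2 x hx.1).mul hl.sin).sub ((h1 x hx.1).mul (hl.cos.const_mul k))
      refine this.congr_deriv ?_
      ring
    · intro x hx
      have hsin : 0 ≤ Real.sin (k * (x - b)) := by
        refine Real.sin_nonneg_of_nonneg_of_le_pi (mul_nonneg hk.le (sub_nonneg.2 hx.1)) ?_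
        have : x - b ≤ π / k := by linarith [hx.2]
        rw [le_div_iff₀ hk] at this
        linarith
      have := hle x hx.1
      exact mul_nonpos_of_nonpos_of_nonneg (by linarith) hsin
  have h := hanti (left_mem_Icc.2 (by linarith)) (right_mem_Icc.2 (by linarith)) (by linarith)
  have hkk : k * (b + π / k - b) = π := by field_simp; ring
  simp only [hkk, sub_self, mul_zero, Real.sin_pi, Real.cos_pi, Real.sin_zero, Real.cos_zero] at h
  have := mul_pos (hpos b le_rfl) hk
  have := mul_pos (hpos (b + π / k) (by linarith)) hk
  linarith

/-- A positive function cannot satisfy `w'' + (n / s) w' ≤ -k w` on a half-line. -/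
theorem not_pos_of_radial_le {w w1 w2 : ℝ → ℝ} {a n k : ℝ} (ha : 0 ≤ a) (hk : 0 < k)
    (h1 : ∀ s, a < s → HasDerivAt w (w1 s) s) (h2 : ∀ s, a < s → HasDerivAt w1 (w2 s) s)
    (hpos : ∀ s, a < s → 0 < w s) (hle : ∀ s, a < s → w2 s + n / s * w1 s ≤ -k * w s) :
    False := by
  set c : ℝ := n / 2 * (n / 2 - 1) with hc
  have hev : ∀ᶠ s in atTop, c / s ^ 2 < k / 2 :=
    (tendsto_const_nhds.div_atTop (tendsto_pow_atTop two_ne_zero)).eventually_lt_const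
      (by positivity)
  obtain ⟨b, hb⟩ := eventually_atTop.1 (hev.and (eventually_gt_atTop a))
  have hpos' : ∀ s, b ≤ s → 0 < s := fun s hs => ha.trans_lt (hb s hs).2
  refine not_pos_of_deriv2_le_neg_sq_mul (b := b) (k := Real.sqrt (k / 2))
    (v := fun s => s ^ (n / 2) * w s)
    (v1 := fun s => s ^ (n / 2) * (w1 s + n / 2 * w s / s))
    (v2 := fun s => s ^ (n / 2) * (w2 s + n / s * w1 s + c / s ^ 2 * w s))
    (Real.sqrt_pos.2 (by positivity)) ?_ ?_ ?_ ?_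
  · intro s hs
    have h0 := hpos' s hs
    have hr := Real.hasDerivAt_rpow_const (x := s) (p := n / 2) (Or.inl h0.ne')
    refine (hr.mul (h1 s (hb s hs).2)).congr_deriv ?_
    rw [Real.rpow_sub_one h0.ne']
    field_simp
    ring
  · intro s hs
    have h0 := hpos' s hs
    have hr := Real.hasDerivAt_rpow_const (x := s) (p := n / 2) (Or.inl h0.ne')
    have hq := ((h1 s (hb s hs).2).const_mul (n / 2)).div (hasDerivAt_id s) h0.ne'
    refine (hr.mul ((h2 s (hb s hs).2).add hq)).congr_deriv ?_
    rw [Real.rpow_sub_one h0.ne', hc]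
    simp only [id, Pi.add_apply, Pi.div_apply]
    field_simp
    ring
  · intro s hs
    exact mul_pos (Real.rpow_pos_of_pos (hpos' s hs) _) (hpos s (hb s hs).2)
  · intro s hs
    have h0 := hpos' s hs
    have hw := hpos s (hb s hs).2
    have hl := hle s (hb s hs).2
    have hcs := mul_le_mul_of_nonneg_right (hb s hs).1.le hw.le
    rw [Real.sq_sqrt (by positivity)]
    have := mul_le_mul_of_nonneg_left
      (show w2 s + n / s * w1 s + c / s ^ 2 * w s ≤ -(k / 2) * w s by linarith)
      (Real.rpow_pos_of_pos h0 (n / 2)).le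
    linarith

/-- First zero to the right of an interval of positivity. -/
theorem exists_first_zero {g : ℝ → ℝ} {a x : ℝ} (hg : ∀ s, a < s → ContinuousAt g s)
    (hinit : ∀ᶠ s in 𝓝[>] a, 0 < g s) (hax : a < x) (hx : g x ≤ 0) :
    ∃ b, a < b ∧ g b = 0 ∧ ∀ s ∈ Ioo a b, 0 < g s := by
  obtain ⟨c, hac, hc⟩ := mem_nhdsGT_iff_exists_Ioo_subset.1 hinit
  have hac : a < c := hac
  have hcx : c ≤ x := by
    by_contra! h
    exact absurd (hc ⟨hax, h⟩) (not_lt.2 hx)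
  set S : Set ℝ := {s | a < s ∧ g s ≤ 0} with hS
  have hbdd : BddBelow S := ⟨a, fun s hs => hs.1.le⟩
  have hne : S.Nonempty := ⟨x, hax, hx⟩
  have hcb : c ≤ sInf S := by
    refine le_csInf hne fun s hs => ?_
    by_contra! h
    exact absurd (hc ⟨hs.1, h⟩) (not_lt.2 hs.2)
  have hab : a < sInf S := hac.trans_le hcb
  have hlt : ∀ s ∈ Ioo a (sInf S), 0 < g s := by
    intro s hs
    by_contra! h
    exact absurd (csInf_le hbdd ⟨hs.1, h⟩) (not_le.2 hs.2)
  refine ⟨sInf S, hab, le_antisymm ?_ ?_, hlt⟩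
  · by_contra! h
    have hev := (hg _ hab).eventually (lt_mem_nhds h)
    obtain ⟨ε, hε, hball⟩ := Metric.eventually_nhds_iff.1 hev
    obtain ⟨s, hs, hsε⟩ := exists_lt_of_csInf_lt hne (lt_add_of_pos_right (sInf S) hε)
    refine absurd (hball (y := s) ?_) (not_lt.2 hs.2)
    rw [Real.dist_eq, abs_of_nonneg (sub_nonneg.2 (csInf_le hbdd hs))]
    linarith
  · refine ge_of_tendsto ((hg _ hab).tendsto.mono_left (nhdsWithin_le_nhds (s := Iio (sInf S)))) ?_
    filter_upwards [Ioo_mem_nhdsLT hab] with s hs using (hlt s hs).le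

theorem deriv_nonpos_of_pos_left {g : ℝ → ℝ} {a b d : ℝ} (hab : a < b) (hd : HasDerivAt g d b)
    (hb : g b = 0) (hpos : ∀ s ∈ Ioo a b, 0 < g s) : d ≤ 0 := by
  have h := hd.tendsto_slope.mono_left (nhdsWithin_mono b (s := Iio b) (fun x hx => ne_of_lt hx))
  refine le_of_tendsto h ?_
  filter_upwards [Ioo_mem_nhdsLT hab] with s hs
  rw [slope_def_field, hb]
  exact div_nonpos_of_nonneg_of_nonpos (by linarith [hpos s hs]) (by linarith [hs.2])

theorem eventually_pos_right_of_deriv_pos {g : ℝ → ℝ} {b d : ℝ} (hd : HasDerivAt g d b)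
    (hb : g b = 0) (hpos : 0 < d) : ∀ᶠ s in 𝓝[>] b, 0 < g s := by
  have h := hd.tendsto_slope.mono_left (nhdsWithin_mono b (s := Ioi b) (fun x hx => ne_of_gt hx))
  filter_upwards [h.eventually (lt_mem_nhds hpos), self_mem_nhdsWithin] with s hs hbs
  rw [slope_def_field, hb, sub_zero] at hs
  exact (div_pos_iff_of_pos_right (sub_pos.2 hbs)).1 hs

theorem rpow_sub_self_ge {p u : ℝ} (hp : 1 < p) (hu : 0 ≤ u) :
    (p - 1) * (u - 1) ≤ u ^ p - u := by
  have := one_add_mul_self_le_rpow_one_add (s := u - 1) (by linarith) hp.le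
  rw [add_sub_cancel] at this
  linarith

theorem self_sub_rpow_ge {p u δ : ℝ} (hp : 1 < p) (hδ : 0 < δ) (hδu : δ ≤ u) (hu : u ≤ 1) :
    δ * min 1 (p - 1) * (1 - u) ≤ u - u ^ p := by
  have hu0 : 0 < u := hδ.trans_le hδu
  have key : min 1 (p - 1) * (1 - u) ≤ 1 - u ^ (p - 1) := by
    rcases le_total 1 (p - 1) with h | h
    · rw [min_eq_left h]
      have := Real.rpow_le_rpow_of_exponent_ge hu0 hu h
      rw [Real.rpow_one] at this
      linarith
    · rw [min_eq_right h]
      have := rpow_one_add_le_one_add_mul_self (s := u - 1) (by linarith)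
        (by linarith : 0 ≤ p - 1) h
      rw [add_sub_cancel] at this
      linarith
  have hmin : 0 ≤ min 1 (p - 1) := le_min zero_le_one (by linarith)
  have h1 : 0 ≤ min 1 (p - 1) * (1 - u) := mul_nonneg hmin (by linarith)
  have h2 : u - u ^ p = u * (1 - u ^ (p - 1)) := by
    rw [Real.rpow_sub_one hu0.ne']
    field_simp
  rw [h2, mul_assoc]
  exact (mul_le_mul_of_nonneg_right hδu h1).trans (mul_le_mul_of_nonneg_left key hu0.le)

theorem potential_lt {p u : ℝ} (hp : 1 < p) (hu : 0 < u) (hne : u ≠ 1) :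
    1 / (p + 1) - 1 / 2 < u ^ (p + 1) / (p + 1) - u ^ 2 / 2 := by
  have h2 : u ^ 2 ≠ 1 := by
    intro h
    exact hne ((pow_eq_one_iff_of_nonneg hu.le two_ne_zero).1 h)
  have hb := one_add_mul_self_lt_rpow_one_add (s := u ^ 2 - 1) (p := (p + 1) / 2)
    (by nlinarith [sq_nonneg u]) (sub_ne_zero.2 h2) (by linarith)
  rw [add_sub_cancel, ← Real.rpow_natCast u 2, ← Real.rpow_mul hu.le] at hb
  have he : ((2 : ℕ) : ℝ) * ((p + 1) / 2) = p + 1 := by push_cast; ring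
  rw [he, Real.rpow_natCast] at hb
  have hp1 : 0 < p + 1 := by linarith
  have : 1 / (p + 1) - 1 / 2 + u ^ 2 / 2 = (1 + (p + 1) / 2 * (u ^ 2 - 1)) / (p + 1) := by
    field_simp
    ring
  have := div_lt_div_of_pos_right hb hp1
  linarith

/-- `u` is a positive solution of `u'' + (n / s) u' - u + u ^ p = 0` on `(0, ∞)` with
derivative `v`. -/
def IsPosRadialSol (n p : ℝ) (u v : ℝ → ℝ) : Prop :=
  (∀ s, 0 < s → HasDerivAt u (v s) s) ∧
  (∀ s, 0 < s → HasDerivAt v (u s - u s ^ p - n / s * v s) s) ∧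
  ∀ s, 0 < s → 0 < u s

namespace IsPosRadialSol

variable {n p : ℝ} {u v : ℝ → ℝ}

/-- Backward uniqueness of the equilibrium `1`. -/
theorem eq_one_of_lt (h : IsPosRadialSol n p u v) (hn : 0 ≤ n) (hp : 1 < p) {s t : ℝ}
    (hs : 0 < s) (hst : s < t) (hu : u t = 1) (hv : v t = 0) : u s = 1 := by
  obtain ⟨h1, h2, h3⟩ := h
  by_contra hne
  set E : ℝ → ℝ := fun x =>
    v x ^ 2 / 2 + u x ^ (p + 1) / (p + 1) - u x ^ 2 / 2 - (1 / (p + 1) - 1 / 2) with hE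
  have hp1 : p + 1 ≠ 0 := by linarith
  have hEge : ∀ x, 0 < x → v x ^ 2 / 2 ≤ E x := by
    intro x hx
    rcases eq_or_ne (u x) 1 with h | h
    · simp only [hE, h, Real.one_rpow, one_pow]
      linarith
    · have := potential_lt hp (h3 x hx) h
      simp only [hE]
      linarith
  have hanti : AntitoneOn (fun x => -(x ^ (2 * n) * E x)) (Icc s t) := by
    refine antitoneOn_Icc_of_hasDerivAt_nonpos
      (f' := fun x => -(2 * n * x ^ (2 * n - 1) * (E x - v x ^ 2 / 2))) ?_ ?_
    · intro x hx
      have h0 : 0 < x := hs.trans_le hx.1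
      have hr := Real.hasDerivAt_rpow_const (x := x) (p := 2 * n) (Or.inl h0.ne')
      have hup := ((h1 x h0).rpow_const (p := p + 1) (Or.inl (h3 x h0).ne')).div_const (p + 1)
      have hEd : HasDerivAt E (-(n / x * v x ^ 2)) x := by
        refine (((((h2 x h0).pow 2).div_const 2).add hup).sub
          (((h1 x h0).pow 2).div_const 2) |>.sub_const _).congr_deriv ?_
        rw [add_sub_cancel_right]
        push_cast
        field_simp
        ring
      refine (hr.mul hEd).neg.congr_deriv ?_
      rw [Real.rpow_sub_one h0.ne']
      field_simp
      ring
    · intro x hx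
      have h0 : 0 < x := hs.trans_le hx.1
      have := hEge x h0
      have := Real.rpow_pos_of_pos h0 (2 * n - 1)
      exact neg_nonpos.2 (mul_nonneg (by positivity) (by linarith))
  have hle := hanti (left_mem_Icc.2 hst.le) (right_mem_Icc.2 hst.le) hst.le
  have hEt : E t = 0 := by
    simp only [hE, hu, hv, Real.one_rpow]
    ring
  have hEs : 0 < E s := by
    have := potential_lt hp (h3 s hs) hne
    have := sq_nonneg (v s)
    simp only [hE]
    linarith
  have := mul_pos (Real.rpow_pos_of_pos hs (2 * n)) hEs
  simp only [hEt, mul_zero, neg_zero] at hle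
  linarith

/-- A solution decreasing on a half-line and falling below `1` decays exponentially. -/
theorem exists_exp_decay (h : IsPosRadialSol n p u v) (hn : 0 ≤ n) (hp : 1 < p) {b : ℝ}
    (hb : 0 < b) (hv : ∀ s, b ≤ s → v s < 0) (hub : u b < 1) :
    ∃ C k : ℝ, 0 < k ∧ ∀ s, b ≤ s → u s ≤ C * Real.exp (-k * s) := by
  obtain ⟨h1, h2, h3⟩ := h
  have hanti : AntitoneOn u (Ici b) := by
    refine antitoneOn_of_hasDerivWithinAt_nonpos (f' := v) (convex_Ici b)
      (fun x hx => (h1 x (hb.trans_le hx)).continuousAt.continuousWithinAt)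
      (fun x hx => (h1 x (hb.trans_le (interior_subset hx))).hasDerivWithinAt)
      (fun x hx => (hv x (interior_subset hx)).le)
  have hule : ∀ s, b ≤ s → u s ≤ u b := fun s hs => hanti self_mem_Ici hs hs
  have hk0 : 0 < 1 - u b ^ (p - 1) :=
    sub_pos.2 (Real.rpow_lt_one (h3 b hb).le hub (by linarith))
  set k := Real.sqrt (1 - u b ^ (p - 1)) with hk
  have hkpos : 0 < k := Real.sqrt_pos.2 hk0
  have hksq : k ^ 2 = 1 - u b ^ (p - 1) := Real.sq_sqrt hk0.le
  have hconv : ∀ s, b ≤ s → k ^ 2 * u s ≤ u s - u s ^ p - n / s * v s := by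
    intro s hs
    have h0 := hb.trans_le hs
    have hus := h3 s h0
    have e1 : u s ^ p = u s ^ (p - 1) * u s := by
      rw [Real.rpow_sub_one hus.ne']
      field_simp
    have e2 := mul_le_mul_of_nonneg_right
      (Real.rpow_le_rpow hus.le (hule s hs) (by linarith : 0 ≤ p - 1)) hus.le
    have e3 : n / s * v s ≤ 0 :=
      mul_nonpos_of_nonneg_of_nonpos (div_nonneg hn h0.le) (hv s hs).le
    rw [hksq, e1]
    linarith
  have hmono : MonotoneOn (fun s => (v s + k * u s) * Real.exp (-k * s)) (Ici b) := by
    have hd : ∀ x, b ≤ x → HasDerivAt (fun s => (v s + k * u s) * Real.exp (-k * s))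
        ((u x - u x ^ p - n / x * v x - k ^ 2 * u x) * Real.exp (-k * x)) x := by
      intro x hx
      have h0 := hb.trans_le hx
      refine (((h2 x h0).add ((h1 x h0).const_mul k)).mul
        (((hasDerivAt_id x).const_mul (-k)).exp)).congr_deriv ?_
      simp only [id, Pi.add_apply]
      ring
    refine monotoneOn_of_hasDerivWithinAt_nonneg (convex_Ici b)
      (fun x hx => (hd x hx).continuousAt.continuousWithinAt)
      (fun x hx => (hd x (interior_subset hx)).hasDerivWithinAt) (fun x hx => ?_)
    exact mul_nonneg (sub_nonneg.2 (hconv x (interior_subset hx))) (Real.exp_pos _).le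
  have hneg : ∀ x, b ≤ x → v x + k * u x ≤ 0 := by
    intro x hx
    by_contra! hc
    set c := v x + k * u x with hcdef
    have hxy : x ≤ x + 1 / c := by
      have : 0 < 1 / c := by positivity
      linarith
    have hby : b ≤ x + 1 / c := hx.trans hxy
    have h4 := hmono (mem_Ici.2 hx) (mem_Ici.2 hby) hxy
    simp only at h4
    have h5 : v (x + 1 / c) + k * u (x + 1 / c) ≤ k := by
      have := hv _ hby
      have := mul_le_mul_of_nonneg_left ((hule _ hby).trans hub.le) hkpos.le
      linarith
    have h6 := h4.trans (mul_le_mul_of_nonneg_right h5 (Real.exp_pos _).le)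
    have h7 : Real.exp (-k * x) = Real.exp (k * (1 / c)) * Real.exp (-k * (x + 1 / c)) := by
      rw [← Real.exp_add]
      ring_nf
    rw [h7, ← hcdef, ← mul_assoc] at h6
    have h8 := le_of_mul_le_mul_right h6 (Real.exp_pos _)
    have h9 := mul_le_mul_of_nonneg_left (Real.add_one_le_exp (k * (1 / c))) hc.le
    have h10 : c * (k * (1 / c) + 1) = k + c := by field_simp
    linarith
  refine ⟨u b * Real.exp (k * b), k, hkpos, fun s hs => ?_⟩
  have hanti2 : AntitoneOn (fun s => u s * Real.exp (k * s)) (Ici b) := by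
    have hd : ∀ x, b ≤ x → HasDerivAt (fun s => u s * Real.exp (k * s))
        ((v x + k * u x) * Real.exp (k * x)) x := by
      intro x hx
      refine ((h1 x (hb.trans_le hx)).mul (((hasDerivAt_id x).const_mul k).exp)).congr_deriv ?_
      simp only [id]
      ring
    refine antitoneOn_of_hasDerivWithinAt_nonpos (convex_Ici b)
      (fun x hx => (hd x hx).continuousAt.continuousWithinAt)
      (fun x hx => (hd x (interior_subset hx)).hasDerivWithinAt) (fun x hx => ?_)
    exact mul_nonpos_of_nonpos_of_nonneg (hneg x (interior_subset hx)) (Real.exp_pos _).le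
  have := hanti2 self_mem_Ici (mem_Ici.2 hs) hs
  simp only at this
  have h11 := mul_le_mul_of_nonneg_right this (Real.exp_pos (-k * s)).le
  rwa [mul_assoc (u s), ← Real.exp_add, show k * s + -k * s = 0 by ring, Real.exp_zero,
    mul_one] at h11

theorem not_one_lt (h : IsPosRadialSol n p u v) (hp : 1 < p) {a : ℝ} (ha : 0 ≤ a) :
    ¬ ∀ s, a < s → 1 < u s := by
  intro hu
  obtain ⟨h1, h2, -⟩ := h
  refine not_pos_of_radial_le (w := fun s => u s - 1) (w1 := v)
    (w2 := fun s => u s - u s ^ p - n / s * v s) (n := n) (k := p - 1) ha (by linarith)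
    (fun s hs => (h1 s (ha.trans_lt hs)).sub_const 1) (fun s hs => h2 s (ha.trans_lt hs))
    (fun s hs => sub_pos.2 (hu s hs)) (fun s hs => ?_)
  have := rpow_sub_self_ge hp (zero_lt_one.trans (hu s hs)).le
  linarith

theorem not_lt_one (h : IsPosRadialSol n p u v) (hp : 1 < p) {a δ : ℝ} (ha : 0 ≤ a)
    (hδ : 0 < δ) : ¬ ∀ s, a < s → δ ≤ u s ∧ u s < 1 := by
  intro hu
  obtain ⟨h1, h2, -⟩ := h
  refine not_pos_of_radial_le (w := fun s => 1 - u s) (w1 := fun s => -v s)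
    (w2 := fun s => -(u s - u s ^ p - n / s * v s)) (n := n) (k := δ * min 1 (p - 1)) ha
    (mul_pos hδ (lt_min zero_lt_one (by linarith)))
    (fun s hs => (h1 s (ha.trans_lt hs)).const_sub 1) (fun s hs => (h2 s (ha.trans_lt hs)).neg)
    (fun s hs => sub_pos.2 (hu s hs).2) (fun s hs => ?_)
  have := self_sub_rpow_ge hp hδ (hu s hs).1 (hu s hs).2.le
  linarith

theorem exists_deriv_nonpos (h : IsPosRadialSol n p u v) (hp : 1 < p) {a : ℝ} (ha : 0 ≤ a) :
    ∃ x, a < x ∧ v x ≤ 0 := by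
  by_contra! hv
  have hmono : StrictMonoOn u (Ioi a) := by
    refine strictMonoOn_of_hasDerivWithinAt_pos (f' := v) (convex_Ioi a)
      (fun x hx => (h.1 x (ha.trans_lt hx)).continuousAt.continuousWithinAt)
      (fun x hx => (h.1 x (ha.trans_lt (interior_subset hx))).hasDerivWithinAt)
      (fun x hx => hv x (interior_subset hx))
  by_cases hc : ∃ b, a < b ∧ 1 ≤ u b
  · obtain ⟨b, hab, hb⟩ := hc
    exact h.not_one_lt hp (ha.trans hab.le) fun s hs =>
      hb.trans_lt (hmono hab (hab.trans hs) hs)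
  · push Not at hc
    have h1 : a < a + 1 := by linarith
    exact h.not_lt_one hp (a := a + 1) (by linarith) (h.2.2 (a + 1) (by linarith)) fun s hs =>
      ⟨(hmono h1 (h1.trans hs) hs).le, hc s (h1.trans hs)⟩

theorem exists_deriv_nonneg (h : IsPosRadialSol n p u v) (hn : 0 ≤ n) (hp : 1 < p)
    (hdecay : ¬ ∃ b C k : ℝ, 0 < k ∧ ∀ s, b ≤ s → u s ≤ C * Real.exp (-k * s))
    {a : ℝ} (ha : 0 ≤ a) : ∃ x, a < x ∧ 0 ≤ v x := by
  by_contra! hv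
  have hanti : StrictAntiOn u (Ioi a) := by
    refine strictAntiOn_of_hasDerivWithinAt_neg (f' := v) (convex_Ioi a)
      (fun x hx => (h.1 x (ha.trans_lt hx)).continuousAt.continuousWithinAt)
      (fun x hx => (h.1 x (ha.trans_lt (interior_subset hx))).hasDerivWithinAt)
      (fun x hx => hv x (interior_subset hx))
  by_cases hc : ∃ b, a < b ∧ u b < 1
  · obtain ⟨b, hab, hb⟩ := hc
    exact hdecay ⟨b, h.exists_exp_decay hn hp (ha.trans_lt hab)
      (fun s hs => hv s (hab.trans_le hs)) hb⟩
  · push Not at hc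
    refine h.not_one_lt hp ha fun s hs => ?_
    have : s < s + 1 := by linarith
    exact (hc (s + 1) (hs.trans this)).trans_lt (hanti hs (mem_Ioi.2 (hs.trans this)) this)

theorem continuousAt_deriv (h : IsPosRadialSol n p u v) {s : ℝ} (hs : 0 < s) :
    ContinuousAt v s := (h.2.1 s hs).continuousAt

theorem self_lt_rpow_iff {p x : ℝ} (hp : 1 < p) (hx : 0 < x) : x < x ^ p ↔ 1 < x := by
  constructor
  · intro h
    by_contra! h1
    have := Real.rpow_le_rpow_of_exponent_ge hx h1 hp.le
    rw [Real.rpow_one] at this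
    linarith
  · intro h
    simpa using Real.rpow_lt_rpow_of_exponent_lt h hp

theorem rpow_lt_self_iff {p x : ℝ} (hp : 1 < p) (hx : 0 < x) : x ^ p < x ↔ x < 1 := by
  constructor
  · intro h
    by_contra! h1
    have := Real.rpow_le_rpow_of_exponent_le h1 hp.le
    rw [Real.rpow_one] at this
    linarith
  · intro h
    simpa using Real.rpow_lt_rpow_of_exponent_gt hx h hp

theorem crit_ne_one (h : IsPosRadialSol n p u v) (hn : 0 ≤ n) (hp : 1 < p)
    (hinit : ∀ᶠ s in 𝓝[>] (0 : ℝ), v s < 0) {t : ℝ} (ht : 0 < t) (hv : v t = 0) :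
    u t ≠ 1 := by
  intro hu
  have hIoo : ∀ᶠ s in 𝓝[>] (0 : ℝ), s ∈ Ioo 0 t := Ioo_mem_nhdsGT ht
  obtain ⟨s, hs, hs0, hst⟩ := (hinit.and hIoo).exists
  have hev : u =ᶠ[𝓝 s] fun _ => 1 := by
    filter_upwards [Ioo_mem_nhds hs0 hst] with x hx
    exact h.eq_one_of_lt hn hp hx.1 hx.2 hu hv
  have := (h.1 s hs0).unique ((hasDerivAt_const s (1 : ℝ)).congr_of_eventuallyEq hev)
  exact hs.ne this

/-- If `v` is negative just to the right of `a`, its next zero is a critical point below `1`. -/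
theorem exists_next_min (h : IsPosRadialSol n p u v) (hn : 0 ≤ n) (hp : 1 < p)
    (hinit : ∀ᶠ s in 𝓝[>] (0 : ℝ), v s < 0)
    (hdecay : ¬ ∃ b C k : ℝ, 0 < k ∧ ∀ s, b ≤ s → u s ≤ C * Real.exp (-k * s))
    {a : ℝ} (ha : 0 ≤ a) (hva : ∀ᶠ s in 𝓝[>] a, v s < 0) :
    ∃ b, a < b ∧ (v b = 0 ∧ u b < 1) ∧ ∀ s ∈ Ioo a b, v s < 0 := by
  obtain ⟨x, hx, hvx⟩ := h.exists_deriv_nonneg hn hp hdecay ha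
  obtain ⟨b, hab, hb, hpos⟩ := exists_first_zero (g := fun s => -v s)
    (fun s hs => (h.continuousAt_deriv (ha.trans_lt hs)).neg)
    (hva.mono fun s hs => neg_pos.2 hs) hx (neg_nonpos.2 hvx)
  have hb0 := ha.trans_lt hab
  have hvb : v b = 0 := neg_eq_zero.1 hb
  refine ⟨b, hab, ⟨hvb, ?_⟩, fun s hs => neg_pos.1 (hpos s hs)⟩
  have hd := deriv_nonpos_of_pos_left hab (h.2.1 b hb0).neg hb hpos
  rw [hvb, mul_zero, sub_zero] at hd
  refine lt_of_le_of_ne (not_lt.1 fun h1 => ?_) (h.crit_ne_one hn hp hinit hb0 hvb)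
  have := (self_lt_rpow_iff hp (h.2.2 b hb0)).2 h1
  linarith

/-- If `v` is positive just to the right of `a`, its next zero is a critical point above `1`. -/
theorem exists_next_max (h : IsPosRadialSol n p u v) (hn : 0 ≤ n) (hp : 1 < p)
    (hinit : ∀ᶠ s in 𝓝[>] (0 : ℝ), v s < 0)
    {a : ℝ} (ha : 0 ≤ a) (hva : ∀ᶠ s in 𝓝[>] a, 0 < v s) :
    ∃ b, a < b ∧ (v b = 0 ∧ 1 < u b) ∧ ∀ s ∈ Ioo a b, 0 < v s := by
  obtain ⟨x, hx, hvx⟩ := h.exists_deriv_nonpos hp ha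
  obtain ⟨b, hab, hb, hpos⟩ := exists_first_zero
    (fun s hs => h.continuousAt_deriv (ha.trans_lt hs)) hva hx hvx
  have hb0 := ha.trans_lt hab
  refine ⟨b, hab, ⟨hb, ?_⟩, hpos⟩
  have hd := deriv_nonpos_of_pos_left hab (h.2.1 b hb0) hb hpos
  rw [hb, mul_zero, sub_zero] at hd
  refine lt_of_le_of_ne (not_lt.1 fun h1 => ?_) (h.crit_ne_one hn hp hinit hb0 hb).symm
  have := (rpow_lt_self_iff hp (h.2.2 b hb0)).2 h1
  linarith

theorem eventually_deriv_pos_of_lt_one (h : IsPosRadialSol n p u v) (hp : 1 < p) {b : ℝ}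
    (hb : 0 < b) (hv : v b = 0) (hu : u b < 1) : ∀ᶠ s in 𝓝[>] b, 0 < v s := by
  refine eventually_pos_right_of_deriv_pos (h.2.1 b hb) hv ?_
  have := (rpow_lt_self_iff hp (h.2.2 b hb)).2 hu
  rw [hv, mul_zero]
  linarith

theorem eventually_deriv_neg_of_one_lt (h : IsPosRadialSol n p u v) (hp : 1 < p) {b : ℝ}
    (hb : 0 < b) (hv : v b = 0) (hu : 1 < u b) : ∀ᶠ s in 𝓝[>] b, v s < 0 := by
  refine (eventually_pos_right_of_deriv_pos (h.2.1 b hb).neg (by simpa using hv) ?_).mono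
    fun s hs => neg_pos.1 hs
  have := (self_lt_rpow_iff hp (h.2.2 b hb)).2 hu
  rw [hv, mul_zero]
  linarith

theorem oscillates (h : IsPosRadialSol n p u v) (hn : 0 ≤ n) (hp : 1 < p)
    (hinit : ∀ᶠ s in 𝓝[>] (0 : ℝ), v s < 0)
    (hdecay : ¬ ∃ b C k : ℝ, 0 < k ∧ ∀ s, b ≤ s → u s ≤ C * Real.exp (-k * s)) :
    ∃ s : ℕ → ℝ, StrictMono s ∧ 0 < s 0 ∧ Tendsto s atTop atTop ∧
      (∀ k : ℕ, v (s k) = 0) ∧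
      (∀ x ∈ Ioo 0 (s 0), v x < 0) ∧
      (∀ k : ℕ, Even k → ∀ x ∈ Ioo (s k) (s (k + 1)), 0 < v x) ∧
      (∀ k : ℕ, Odd k → ∀ x ∈ Ioo (s k) (s (k + 1)), v x < 0) ∧
      (∀ k : ℕ, Even k → u (s k) < 1) ∧
      (∀ k : ℕ, Odd k → 1 < u (s k)) := by
  obtain ⟨s0, hs0, hs0c, hs0v⟩ := h.exists_next_min hn hp hinit hdecay le_rfl hinit
  have hmin : ∀ a, 0 < a → v a = 0 → u a < 1 →
      ∃ b, a < b ∧ (v b = 0 ∧ 1 < u b) ∧ ∀ s ∈ Ioo a b, 0 < v s := fun a ha hv hu =>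
    h.exists_next_max hn hp hinit ha.le (h.eventually_deriv_pos_of_lt_one hp ha hv hu)
  have hmax : ∀ a, 0 < a → v a = 0 → 1 < u a →
      ∃ b, a < b ∧ (v b = 0 ∧ u b < 1) ∧ ∀ s ∈ Ioo a b, v s < 0 := fun a ha hv hu =>
    h.exists_next_min hn hp hinit hdecay ha.le (h.eventually_deriv_neg_of_one_lt hp ha hv hu)
  choose! f hf using hmin
  choose! g hg using hmax
  set s : ℕ → ℝ := fun k => Nat.rec s0 (fun k x => if Even k then f x else g x) k with hs
  have hse : ∀ k, Even k → s (k + 1) = f (s k) := fun k hk => if_pos hk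
  have hso : ∀ k, Odd k → s (k + 1) = g (s k) := fun k hk =>
    if_neg (Nat.not_even_iff_odd.2 hk)
  have key : ∀ k, 0 < s k ∧ v (s k) = 0 ∧ (Even k → u (s k) < 1) ∧ (Odd k → 1 < u (s k)) := by
    intro k
    induction k with
    | zero => exact ⟨hs0, hs0c.1, fun _ => hs0c.2, fun h0 => absurd h0 (by decide)⟩
    | succ k ih =>
      obtain ⟨i1, i2, i3, i4⟩ := ih
      rcases Nat.even_or_odd k with hk | hk
      · obtain ⟨j1, j2, -⟩ := hf _ i1 i2 (i3 hk)
        rw [hse k hk]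
        exact ⟨i1.trans j1, j2.1,
          fun hk' => absurd hk.add_one (Nat.not_odd_iff_even.2 hk'), fun _ => j2.2⟩
      · obtain ⟨j1, j2, -⟩ := hg _ i1 i2 (i4 hk)
        rw [hso k hk]
        exact ⟨i1.trans j1, j2.1, fun _ => j2.2,
          fun hk' => absurd hk.add_one (Nat.not_even_iff_odd.2 hk')⟩
  have hmono : StrictMono s := by
    refine strictMono_nat_of_lt_succ fun k => ?_
    obtain ⟨i1, i2, i3, i4⟩ := key k
    rcases Nat.even_or_odd k with hk | hk
    · rw [hse k hk]
      exact (hf _ i1 i2 (i3 hk)).1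
    · rw [hso k hk]
      exact (hg _ i1 i2 (i4 hk)).1
  refine ⟨s, hmono, hs0, ?_, fun k => (key k).2.1, hs0v, fun k hk => ?_, fun k hk => ?_,
    fun k => (key k).2.2.1, fun k => (key k).2.2.2⟩
  · rcases tendsto_atTop_of_monotone hmono.monotone with ht | ⟨l, hl⟩
    · exact ht
    · exfalso
      have hl0 : 0 < l := hs0.trans_le (hmono.monotone.ge_of_tendsto hl 0)
      have hul := (h.1 l hl0).continuousAt.tendsto.comp hl
      have hvl := (h.continuousAt_deriv hl0).tendsto.comp hl
      have hv0 : v l = 0 := by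
        refine tendsto_nhds_unique hvl ?_
        simp only [Function.comp_def, (key _).2.1]
        exact tendsto_const_nhds
      have he : Tendsto (fun k : ℕ => 2 * k) atTop atTop :=
        tendsto_id.const_mul_atTop' two_pos
      have ho : Tendsto (fun k : ℕ => 2 * k + 1) atTop atTop :=
        tendsto_atTop_mono (fun k => Nat.le_succ (2 * k)) he
      refine h.crit_ne_one hn hp hinit hl0 hv0 (le_antisymm ?_ ?_)
      · exact le_of_tendsto' (hul.comp he) fun k => ((key _).2.2.1 (even_two_mul k)).le
      · exact ge_of_tendsto' (hul.comp ho) fun k => ((key _).2.2.2 (odd_two_mul_add_one k)).le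
  · rw [hse k hk]
    exact (hf _ (key k).1 (key k).2.1 ((key k).2.2.1 hk)).2.2
  · rw [hso k hk]
    exact (hg _ (key k).1 (key k).2.1 ((key k).2.2.2 hk)).2.2

end IsPosRadialSol

/-- If `y` converges at `-∞` and `y'' + c y' → 0` at `-∞`, then `y' → 0` at `-∞`. -/
theorem tendsto_deriv_atBot_zero {y y' y'' : ℝ → ℝ} {c l : ℝ} (h1 : ∀ t, HasDerivAt y (y' t) t)
    (h2 : ∀ t, HasDerivAt y' (y'' t) t) (hy : Tendsto y atBot (𝓝 l))
    (hg : Tendsto (fun t => y'' t + c * y' t) atBot (𝓝 0)) : Tendsto y' atBot (𝓝 0) := by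
  have hmv : ∀ t : ℝ, ∃ x z, x ≤ t ∧ z ≤ t ∧
      y' t = y t - y (t - 1) - c * (y t - y x) + (y'' z + c * y' z) * (t - x) ∧
      0 ≤ t - x ∧ t - x ≤ 1 := by
    intro t
    obtain ⟨x, hx, he⟩ := exists_hasDerivAt_eq_slope y y' (by linarith : t - 1 < t)
      (fun x _ => (h1 x).continuousAt.continuousWithinAt) (fun x _ => h1 x)
    obtain ⟨z, hz, he2⟩ := exists_hasDerivAt_eq_slope (fun t => y' t + c * y t)
      (fun t => y'' t + c * y' t) hx.2
      (fun x _ => ((h2 x).add ((h1 x).const_mul c)).continuousAt.continuousWithinAt)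
      (fun x _ => (h2 x).add ((h1 x).const_mul c))
    have h0 : t - x ≠ 0 := by linarith [hx.2]
    refine ⟨x, z, hx.2.le, hz.2.le, ?_, by linarith [hx.2], by linarith [hx.1]⟩
    rw [he2, div_mul_cancel₀ _ h0, he]
    simp only [sub_sub_cancel, div_one]
    ring
  choose x z hx hz he h0 h1' using hmv
  have htx : Tendsto x atBot atBot := tendsto_atBot_mono hx tendsto_id
  have htz : Tendsto z atBot atBot := tendsto_atBot_mono hz tendsto_id
  have ht1 : Tendsto (fun t : ℝ => t - 1) atBot atBot :=
    tendsto_atBot_mono (fun t => (sub_one_lt t).le) tendsto_id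
  have hlast : Tendsto (fun t => (y'' (z t) + c * y' (z t)) * (t - x t)) atBot (𝓝 0) := by
    refine squeeze_zero_norm (fun t => ?_) (by simpa using (hg.comp htz).norm)
    rw [norm_mul]
    refine mul_le_of_le_one_right (norm_nonneg _) ?_
    rw [Real.norm_of_nonneg (h0 t)]
    exact h1' t
  have := ((hy.sub (hy.comp ht1)).sub ((hy.sub (hy.comp htx)).const_mul c)).add hlast
  simp only [sub_self, mul_zero, add_zero] at this
  exact this.congr fun t => (he t).symm

section Parameters

variable {N : ℕ} {p : ℝ}

theorem thetaP_pos (hp : 1 < p) : 0 < thetaP p := div_pos two_pos (by linarith)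

theorem two_mul_thetaP_lt (hN : 3 ≤ N) (hp : 1 < p) (hpS : pSob N < p) :
    2 * thetaP p < (N : ℝ) - 2 := by
  have hN' : (3 : ℝ) ≤ N := by exact_mod_cast hN
  have h2 : (0 : ℝ) < N - 2 := by linarith
  rw [pSob, div_lt_iff₀ h2] at hpS
  rw [thetaP, mul_div_assoc', div_lt_iff₀ (by linarith)]
  linarith

theorem theta_mul_pos (hN : 3 ≤ N) (hp : 1 < p) (hpS : pSob N < p) :
    0 < thetaP p * ((N : ℝ) - 2 - thetaP p) :=
  mul_pos (thetaP_pos hp) (by linarith [thetaP_pos hp, two_mul_thetaP_lt hN hp hpS])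

theorem mConst_pos (hN : 3 ≤ N) (hp : 1 < p) (hpS : pSob N < p) : 0 < mConst N p :=
  Real.rpow_pos_of_pos (theta_mul_pos hN hp hpS) _

theorem Aconst_pos (hN : 3 ≤ N) (hp : 1 < p) (hpS : pSob N < p) : 0 < Aconst N p :=
  Real.rpow_pos_of_pos (theta_mul_pos hN hp hpS) _

theorem alphaConst_pos (hN : 3 ≤ N) (hp : 1 < p) (hpS : pSob N < p) : 0 < alphaConst N p :=
  mul_pos (mConst_pos hN hp hpS) (by linarith [two_mul_thetaP_lt hN hp hpS])

theorem mConst_sq_mul (hN : 3 ≤ N) (hp : 1 < p) (hpS : pSob N < p) :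
    mConst N p ^ 2 * (thetaP p * ((N : ℝ) - 2 - thetaP p)) = 1 := by
  have h := theta_mul_pos hN hp hpS
  rw [mConst, ← Real.rpow_natCast, ← Real.rpow_mul h.le, ← Real.rpow_add_one h.ne']
  norm_num

theorem Aconst_rpow (hN : 3 ≤ N) (hp : 1 < p) (hpS : pSob N < p) :
    Aconst N p ^ p = Aconst N p * (thetaP p * ((N : ℝ) - 2 - thetaP p)) := by
  have h := theta_mul_pos hN hp hpS
  have hA := Aconst_pos hN hp hpS
  have hp1 : p - 1 ≠ 0 := by linarith
  have : Aconst N p ^ (p - 1) = thetaP p * ((N : ℝ) - 2 - thetaP p) := by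
    rw [Aconst, ← Real.rpow_mul h.le, one_div, inv_mul_cancel₀ hp1, Real.rpow_one]
  rw [← this, ← Real.rpow_one_add' hA.le (by linarith)]
  ring_nf

theorem thetaP_mul (hp : 1 < p) : thetaP p * p = thetaP p + 2 := by
  have hp1 : p - 1 ≠ 0 := by linarith
  rw [thetaP]
  field_simp
  ring

end Parameters

/-- The energy of the equation in logarithmic coordinates. -/
def logEnergy (N : ℕ) (p : ℝ) (y y' : ℝ → ℝ) (t : ℝ) : ℝ :=
  y' t ^ 2 / 2 - y t ^ 2 / 2 + y t ^ (p + 1) / (p + 1)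
    - mConst N p ^ 2 * Real.exp (2 * mConst N p * t) * y t ^ 2 / 2

namespace IsEntireSingODE

variable {N : ℕ} {p : ℝ} {y y' y'' : ℝ → ℝ}

theorem tendsto_exp_atBot (hm : 0 < mConst N p) :
    Tendsto (fun t => Real.exp (2 * mConst N p * t)) atBot (𝓝 0) :=
  Real.tendsto_exp_atBot.comp (tendsto_id.const_mul_atBot (by positivity))

theorem tendsto_deriv (h : IsEntireSingODE N p y y' y'') (hm : 0 < mConst N p) :
    Tendsto y' atBot (𝓝 0) := by
  obtain ⟨h1, h2, -, h4, h5⟩ := h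
  refine tendsto_deriv_atBot_zero (c := alphaConst N p) h1 h2 h5 ?_
  have hpow : Tendsto (fun t => y t ^ p) atBot (𝓝 (1 ^ p)) :=
    h5.rpow_const (Or.inl one_ne_zero)
  have := (h5.sub hpow).add (((tendsto_exp_atBot hm).const_mul (mConst N p ^ 2)).mul h5)
  simp only [Real.one_rpow, sub_self, mul_zero, zero_mul, add_zero] at this
  refine this.congr fun t => ?_
  linarith [h4 t]

theorem logEnergy_le (h : IsEntireSingODE N p y y' y'') (hp : 1 < p) (hm : 0 < mConst N p)
    (hα : 0 < alphaConst N p) (t : ℝ) : logEnergy N p y y' t ≤ 1 / (p + 1) - 1 / 2 := by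
  have hy' := h.tendsto_deriv hm
  obtain ⟨h1, h2, -, h4, h5⟩ := h
  have hp1 : p + 1 ≠ 0 := by linarith
  have hd : ∀ t, HasDerivAt (logEnergy N p y y') (-(alphaConst N p * y' t ^ 2
      + mConst N p ^ 3 * Real.exp (2 * mConst N p * t) * y t ^ 2)) t := by
    intro t
    have hup := ((h1 t).rpow_const (p := p + 1) (Or.inr (by linarith))).div_const (p + 1)
    have hexp := ((hasDerivAt_id t).const_mul (2 * mConst N p)).exp
    refine ((((((h2 t).pow 2).div_const 2).sub (((h1 t).pow 2).div_const 2)).add hup).sub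
      (((hexp.const_mul (mConst N p ^ 2)).mul ((h1 t).pow 2)).div_const 2)).congr_deriv ?_
    have e : y'' t = -alphaConst N p * y' t + y t - y t ^ p
      + (mConst N p) ^ 2 * Real.exp (2 * mConst N p * t) * y t := by linarith [h4 t]
    rw [add_sub_cancel_right, e]
    simp only [id, Pi.pow_apply]
    push_cast
    field_simp
    ring
  have hanti : Antitone (logEnergy N p y y') := by
    refine antitone_of_hasDerivAt_nonpos hd fun t => ?_
    exact neg_nonpos.2 (by positivity)
  have hlim : Tendsto (logEnergy N p y y') atBot (𝓝 (1 / (p + 1) - 1 / 2)) := by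
    have hpow : Tendsto (fun t => y t ^ (p + 1)) atBot (𝓝 (1 ^ (p + 1))) :=
      h5.rpow_const (Or.inl one_ne_zero)
    have := ((((hy'.pow 2).div_const 2).sub ((h5.pow 2).div_const 2)).add
      (hpow.div_const (p + 1))).sub ((((tendsto_exp_atBot hm).const_mul
        (mConst N p ^ 2)).mul (h5.pow 2)).div_const 2)
    rw [show 1 / (p + 1) - 1 / 2 = (0 : ℝ) ^ 2 / 2 - 1 ^ 2 / 2 + 1 ^ (p + 1) / (p + 1)
      - mConst N p ^ 2 * 0 * 1 ^ 2 / 2 by rw [Real.one_rpow]; ring]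
    exact this
  exact hanti.ge_of_tendsto hlim t

theorem energy_bound_neg (hp : 1 < p) : 1 / (p + 1) - 1 / 2 < 0 := by
  have := one_div_lt_one_div_of_lt two_pos (by linarith : (2 : ℝ) < p + 1)
  linarith

theorem pos (h : IsEntireSingODE N p y y' y'') (hp : 1 < p) (hm : 0 < mConst N p)
    (hα : 0 < alphaConst N p) (t : ℝ) : 0 < y t := by
  have hne : ∀ s, y s ≠ 0 := by
    intro s hs
    have hle := (h.logEnergy_le hp hm hα s).trans_lt (energy_bound_neg hp)
    rw [logEnergy, hs, Real.zero_rpow (by linarith)] at hle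
    have := sq_nonneg (y' s)
    norm_num at hle
    linarith
  have hcont : Continuous y := continuous_iff_continuousAt.2 fun s => (h.1 s).continuousAt
  obtain ⟨s, hs⟩ := (h.2.2.2.2.eventually (lt_mem_nhds zero_lt_one)).exists
  by_contra! ht
  obtain ⟨r, hr⟩ := mem_range_of_exists_le_of_exists_ge hcont ⟨t, ht⟩ ⟨s, hs.le⟩
  exact hne r hr

theorem exp_two_mul_log_div {m s : ℝ} (hm : m ≠ 0) (hs : 0 < s) :
    Real.exp (2 * m * (Real.log s / m)) = s ^ 2 := by
  rw [show 2 * m * (Real.log s / m) = Real.log s + Real.log s by field_simp; ring,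
    Real.exp_add, Real.exp_log hs, sq]

theorem hasDerivAt_ustar (h : IsEntireSingODE N p y y' y'') (hm : 0 < mConst N p) {s : ℝ}
    (hs : 0 < s) : HasDerivAt (ustar N p y) (Aconst N p * s ^ (-thetaP p - 1) *
      (-thetaP p * y (Real.log s / mConst N p)
        + y' (Real.log s / mConst N p) / mConst N p)) s := by
  have hr := (Real.hasDerivAt_rpow_const (x := s) (p := -thetaP p) (Or.inl hs.ne')).const_mul
    (Aconst N p)
  have hl := (Real.hasDerivAt_log hs.ne').div_const (mConst N p)
  refine (hr.mul ((h.1 _).comp s hl)).congr_deriv ?_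
  rw [Real.rpow_sub_one hs.ne']
  simp only [Function.comp_apply]
  field_simp

theorem isPosRadialSol_ustar (h : IsEntireSingODE N p y y' y'') (hN : 3 ≤ N) (hp : 1 < p)
    (hpS : pSob N < p) : IsPosRadialSol ((N : ℝ) - 1) p (ustar N p y)
      (fun s => Aconst N p * s ^ (-thetaP p - 1) * (-thetaP p * y (Real.log s / mConst N p)
        + y' (Real.log s / mConst N p) / mConst N p)) := by
  have hm := mConst_pos hN hp hpS
  have hA := Aconst_pos hN hp hpS
  have hpos := h.pos hp hm (alphaConst_pos hN hp hpS)
  refine ⟨fun s hs => h.hasDerivAt_ustar hm hs, fun s hs => ?_, fun s hs =>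
    mul_pos (mul_pos hA (Real.rpow_pos_of_pos hs _)) (hpos _)⟩
  have hr := (Real.hasDerivAt_rpow_const (x := s) (p := -thetaP p - 1)
    (Or.inl hs.ne')).const_mul (Aconst N p)
  have hl := (Real.hasDerivAt_log hs.ne').div_const (mConst N p)
  refine (hr.mul ((((h.1 _).comp s hl).const_mul (-thetaP p)).add
    (((h.2.1 _).comp s hl).div_const (mConst N p)))).congr_deriv ?_
  have hode := h.2.2.2.1 (Real.log s / mConst N p)
  have hexp : Real.exp (2 * mConst N p * (Real.log s / mConst N p)) = s ^ 2 :=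
    exp_two_mul_log_div hm.ne' hs
  have hsp : (s ^ (-thetaP p)) ^ p = s ^ (-thetaP p) / s ^ 2 := by
    rw [← Real.rpow_mul hs.le, neg_mul, thetaP_mul hp, neg_add, ← sub_eq_add_neg,
      Real.rpow_sub hs, Real.rpow_two]
  have hup : ustar N p y s ^ p = Aconst N p * (thetaP p * ((N : ℝ) - 2 - thetaP p)) *
      (s ^ (-thetaP p) / s ^ 2) * y (Real.log s / mConst N p) ^ p := by
    rw [ustar, Real.mul_rpow (mul_nonneg hA.le (Real.rpow_pos_of_pos hs _).le) (hpos _).le,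
      Real.mul_rpow hA.le (Real.rpow_pos_of_pos hs _).le, hsp, Aconst_rpow hN hp hpS]
  have hDm := mConst_sq_mul hN hp hpS
  have hD : thetaP p * ((N : ℝ) - 2 - thetaP p) = 1 / mConst N p ^ 2 := by
    field_simp
    linarith
  rw [hexp] at hode
  simp only [Function.comp_apply, Pi.add_apply]
  rw [hup, ustar, Real.rpow_sub_one hs.ne', Real.rpow_sub_one hs.ne']
  generalize Real.log s / mConst N p = t at *
  have e : y'' t = -alphaConst N p * y' t + y t - y t ^ p
      + (mConst N p) ^ 2 * s ^ 2 * y t := by linarith [hode]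
  rw [e, hD, alphaConst]
  field_simp
  generalize y t ^ p = Y at *
  linear_combination (-(y t)) * hDm

theorem tendsto_log_div_atBot (hm : 0 < mConst N p) :
    Tendsto (fun s => Real.log s / mConst N p) (𝓝[>] 0) atBot :=
  Real.tendsto_log_nhdsGT_zero.atBot_div_const hm

theorem eventually_deriv_ustar_neg (h : IsEntireSingODE N p y y' y'') (hN : 3 ≤ N) (hp : 1 < p)
    (hpS : pSob N < p) : ∀ᶠ s in 𝓝[>] (0 : ℝ), Aconst N p * s ^ (-thetaP p - 1) *
      (-thetaP p * y (Real.log s / mConst N p)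
        + y' (Real.log s / mConst N p) / mConst N p) < 0 := by
  have hm := mConst_pos hN hp hpS
  have hlim := ((h.2.2.2.2.const_mul (-thetaP p)).add
    ((h.tendsto_deriv hm).div_const (mConst N p))).comp (tendsto_log_div_atBot hm)
  have hneg : -thetaP p * 1 + 0 / mConst N p < 0 := by
    have := thetaP_pos hp
    simpa using this
  filter_upwards [hlim.eventually (gt_mem_nhds hneg), self_mem_nhdsWithin] with s hs hs0
  exact mul_neg_of_pos_of_neg
    (mul_pos (Aconst_pos hN hp hpS) (Real.rpow_pos_of_pos hs0 _)) hs

/-- The singular solution does not decay exponentially, as its energy in logarithmic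
coordinates stays away from `0`. -/
theorem not_exp_decay (h : IsEntireSingODE N p y y' y'') (hN : 3 ≤ N) (hp : 1 < p)
    (hpS : pSob N < p) :
    ¬ ∃ b C k : ℝ, 0 < k ∧ ∀ s, b ≤ s → ustar N p y s ≤ C * Real.exp (-k * s) := by
  rintro ⟨b, C, k, hk, hdec⟩
  have hm := mConst_pos hN hp hpS
  have hA := Aconst_pos hN hp hpS
  have hα := alphaConst_pos hN hp hpS
  have hpos := h.pos hp hm hα
  have hlim : ∀ c : ℝ, Tendsto (fun s => C / Aconst N p * (s ^ c * Real.exp (-k * s))) atTop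
      (𝓝 0) := fun c => by
    simpa using (tendsto_rpow_mul_exp_neg_mul_atTop_nhds_zero c k hk).const_mul (C / Aconst N p)
  have hsum : Tendsto (fun s =>
      (C / Aconst N p * (s ^ thetaP p * Real.exp (-k * s))) ^ 2 / 2 + mConst N p ^ 2 *
      (C / Aconst N p * (s ^ (thetaP p + 1) * Real.exp (-k * s))) ^ 2 / 2) atTop (𝓝 0) := by
    simpa using (((hlim (thetaP p)).pow 2).div_const 2).add
      ((((hlim (thetaP p + 1)).pow 2).const_mul (mConst N p ^ 2)).div_const 2)
  obtain ⟨s, hs, hs0, hbs⟩ := ((hsum.eventually (gt_mem_nhds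
    (neg_pos.2 (energy_bound_neg hp)))).and
      ((eventually_gt_atTop 0).and (eventually_ge_atTop b))).exists
  have hd := hdec s hbs
  set t := Real.log s / mConst N p with ht
  have hyle : y t ≤ C / Aconst N p * (s ^ thetaP p * Real.exp (-k * s)) := by
    have hpw := Real.rpow_pos_of_pos hs0 (thetaP p)
    rw [ustar, Real.rpow_neg hs0.le, ← ht] at hd
    have := mul_le_mul_of_nonneg_left hd (div_nonneg hpw.le hA.le)
    have e1 : s ^ thetaP p / Aconst N p * (Aconst N p * (s ^ thetaP p)⁻¹ * y t) = y t := by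
      field_simp
    rw [e1] at this
    refine this.trans_eq ?_
    ring
  have hexp : Real.exp (2 * mConst N p * t) = s ^ 2 := exp_two_mul_log_div hm.ne' hs0
  have hle := h.logEnergy_le hp hm hα t
  have hyp : 0 ≤ y t ^ (p + 1) / (p + 1) :=
    div_nonneg (Real.rpow_pos_of_pos (hpos t) _).le (by linarith)
  have hy2 := pow_le_pow_left₀ (hpos t).le hyle 2
  have hy3 := mul_le_mul_of_nonneg_left hy2 (by positivity : 0 ≤ mConst N p ^ 2 * s ^ 2)
  rw [Real.rpow_add_one hs0.ne'] at hs
  rw [logEnergy, hexp] at hle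
  have := sq_nonneg (y' t)
  have e2 : mConst N p ^ 2 * (C / Aconst N p * (s ^ thetaP p * s * Real.exp (-k * s))) ^ 2
      = mConst N p ^ 2 * s ^ 2 * (C / Aconst N p * (s ^ thetaP p * Real.exp (-k * s))) ^ 2 := by
    ring
  rw [e2] at hs
  linarith

end IsEntireSingODE

/-- for `p_S < p < p_JL`, the singular solution `u*` has an increasing,
divergent sequence of positive critical points, alternately local minima below `1`
(odd-numbered, i.e. even index `k` here) and local maxima above `1`. -/
theorem ustar_oscillates (N : ℕ) (hN : 3 ≤ N) (p : ℝ) (hp : 1 < p)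
    (hpS : pSob N < p) (hJL : pJLcond N p)
    (ys ys' ys'' : ℝ → ℝ) (hys : IsEntireSingODE N p ys ys' ys'') :
    ∃ s : ℕ → ℝ, StrictMono s ∧ 0 < s 0 ∧ Tendsto s atTop atTop ∧
      (∀ k : ℕ, deriv (ustar N p ys) (s k) = 0) ∧
      (∀ x ∈ Ioo 0 (s 0), deriv (ustar N p ys) x < 0) ∧
      (∀ k : ℕ, Even k → ∀ x ∈ Ioo (s k) (s (k + 1)), 0 < deriv (ustar N p ys) x) ∧
      (∀ k : ℕ, Odd k → ∀ x ∈ Ioo (s k) (s (k + 1)), deriv (ustar N p ys) x < 0) ∧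
      (∀ k : ℕ, Even k → ustar N p ys (s k) < 1) ∧
      (∀ k : ℕ, Odd k → 1 < ustar N p ys (s k)) := by
  have hN' : (3 : ℝ) ≤ N := by exact_mod_cast hN
  obtain ⟨s, hs1, hs2, hs3, h1, h2, h3, h4, h5, h6⟩ :=
    (hys.isPosRadialSol_ustar hN hp hpS).oscillates (by linarith) hp
      (hys.eventually_deriv_ustar_neg hN hp hpS) (hys.not_exp_decay hN hp hpS)
  have hd : ∀ x, 0 < x → deriv (ustar N p ys) x = _ := fun x hx =>
    (hys.hasDerivAt_ustar (mConst_pos hN hp hpS) hx).deriv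
  have hpos : ∀ k, 0 < s k := fun k => hs2.trans_le (hs1.monotone (Nat.zero_le k))
  refine ⟨s, hs1, hs2, hs3, fun k => (hd _ (hpos k)).trans (h1 k),
    fun x hx => (hd x hx.1).trans_lt (h2 x hx),
    fun k hk x hx => (h3 k hk x hx).trans_eq (hd x ((hpos k).trans hx.1)).symm,
    fun k hk x hx => (hd x ((hpos k).trans hx.1)).trans_lt (h4 k hk x hx), h5, h6⟩
end
end
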